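/- Nonemptiness of the relative limiting subdifferential. Let f : X → ℝ̄ be lower semicontinuous relative to a set Ω ⊆ X, and let Ω be locally closed around x̄ ∈ Ω ∩ dom f. If f is locally Lipschitz relative to Ω around x̄ (with some modulus ℓ ≥ 0), then ∂_Ω f(x̄) ≠ ∅. -/

import Mathlib

open Filter Topology Set

noncomputable section

/-- A normed space is locally uniformly convex. -/
def LocUnifConvex (E : Type*) [NormedAddCommGroup E] : Prop :=
  ∀ x : E, ‖x‖ = 1 → ∀ ε : ℝ, 0 < ε →
    ∃ δ : ℝ, 0 < δ ∧ ∀ y : E, ‖y‖ = 1 → 2 - δ < ‖x + y‖ → ‖x - y‖ < ε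

/-- Standing assumptions of the paper: `X` is reflexive, both `X` and its dual `X*` are
locally uniformly convex, and the norm of `X` is Fréchet differentiable at every
nonzero point. -/
def StandingAssumptions (X : Type*) [NormedAddCommGroup X] [NormedSpace ℝ X] : Prop :=
  Function.Surjective (⇑(NormedSpace.inclusionInDoubleDual ℝ X)) ∧
  LocUnifConvex X ∧ LocUnifConvex (X →L[ℝ] ℝ) ∧
  ∀ x : X, x ≠ 0 → DifferentiableAt ℝ (fun y : X => ‖y‖) x

variable {X : Type*}

open scoped Classical in
/-- The restriction `f_Ω` of `f` to `Ω` (equal to `+∞` off `Ω`). -/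
def restr (f : X → EReal) (Ω : Set X) : X → EReal := fun x => if x ∈ Ω then f x else ⊤

/-- The epigraph of an extended-real-valued function, as a subset of `X × ℝ`. -/
def epiSet (g : X → EReal) : Set (X × ℝ) := {p | g p.1 ≤ (p.2 : EReal)}

/-- The paper's addition on `ℝ̄ = ℝ ∪ {±∞}`, with the convention `∞ - ∞ = ∞`
(i.e. `⊤` dominates). -/
def pAdd (a b : EReal) : EReal := if a = ⊤ ∨ b = ⊤ then ⊤ else a + b

section NormedX
variable [NormedAddCommGroup X] [NormedSpace ℝ X]

/-- The `ε`-normal set to `S ⊆ X` at `xb`. -/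
def eNormal (ε : ℝ) (xb : X) (S : Set X) : Set (X →L[ℝ] ℝ) :=
  {xs | Filter.limsup (fun x => ((xs (x - xb) / ‖x - xb‖ : ℝ) : EReal))
      (nhdsWithin xb S) ≤ (ε : EReal)}

/-- The `ε`-normal set to `S ⊆ X × ℝ` at `zb`, where `X × ℝ` carries the norm
`‖(x, r)‖ = ‖x‖ + |r|` and the dual pairing is
`⟨(x*, r*), (x, r)⟩ = ⟨x*, x⟩ + r* r`. -/
def eNormalProd (ε : ℝ) (zb : X × ℝ) (S : Set (X × ℝ)) : Set ((X →L[ℝ] ℝ) × ℝ) :=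
  {zs | Filter.limsup
      (fun z => (((zs.1 (z.1 - zb.1) + zs.2 * (z.2 - zb.2)) /
        (‖z.1 - zb.1‖ + |z.2 - zb.2|) : ℝ) : EReal)) (nhdsWithin zb S) ≤ (ε : EReal)}

/-- The tangent cone to `Ω` at `xb`. -/
def tanCone (Ω : Set X) (xb : X) : Set X :=
  {v | ∃ (t : ℕ → ℝ) (w : ℕ → X), (∀ k, 0 < t k) ∧ Tendsto t atTop (nhds 0) ∧
    Tendsto w atTop (nhds v) ∧ ∀ k, xb + t k • w k ∈ Ω}

/-- The duality mapping `J(x) = {x* : ⟨x*, x⟩ = ‖x‖² = ‖x*‖²}`. -/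
def dualityMap (x : X) : Set (X →L[ℝ] ℝ) := {xs | xs x = ‖x‖ ^ 2 ∧ xs x = ‖xs‖ ^ 2}

/-- `J(A) = ⋃ x ∈ A, J(x)`. -/
def dualityMapSet (A : Set X) : Set (X →L[ℝ] ℝ) := ⋃ x ∈ A, dualityMap x

/-- The geometric `ε`-subdifferential `∂̂_ε g(xb)` (empty unless `g(xb)` is finite). -/
def geomSub (ε : ℝ) (g : X → EReal) (xb : X) : Set (X →L[ℝ] ℝ) :=
  {xs | ∃ r : ℝ, g xb = (r : EReal) ∧ (xs, (-1 : ℝ)) ∈ eNormalProd ε (xb, r) (epiSet g)}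

/-- The `ε`-regular subdifferential of `f` relative to `Ω` at `xb`:
`∂̂^ε_Ω f(xb) = ∂̂_ε f_Ω(xb) ∩ J(T(xb, Ω))`. -/
def relRegSub (ε : ℝ) (Ω : Set X) (f : X → EReal) (xb : X) : Set (X →L[ℝ] ℝ) :=
  geomSub ε (restr f Ω) xb ∩ dualityMapSet (tanCone Ω xb)

/-- Weak* convergence of a sequence of functionals. -/
def WeakStarTendsto (u : ℕ → X →L[ℝ] ℝ) (l : X →L[ℝ] ℝ) : Prop :=
  ∀ v : X, Tendsto (fun k => u k v) atTop (nhds (l v))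

/-- The limiting subdifferential of `f` relative to `Ω` at `xb`. -/
def relLimSub (Ω : Set X) (f : X → EReal) (xb : X) : Set (X →L[ℝ] ℝ) :=
  {xs | ∃ (ε : ℕ → ℝ) (x : ℕ → X) (u : ℕ → X →L[ℝ] ℝ),
    (∀ k, 0 < ε k) ∧ Antitone ε ∧ Tendsto ε atTop (nhds 0) ∧
    (∀ k, x k ∈ Ω) ∧ Tendsto x atTop (nhds xb) ∧
    Tendsto (fun k => f (x k)) atTop (nhds (f xb)) ∧
    (∀ k, u k ∈ relRegSub (ε k) Ω f (x k)) ∧ WeakStarTendsto u xs}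

/-- The (Mordukhovich) limiting subdifferential of `g` at `xb`. -/
def limSub (g : X → EReal) (xb : X) : Set (X →L[ℝ] ℝ) :=
  {xs | ∃ (ε : ℕ → ℝ) (x : ℕ → X) (u : ℕ → X →L[ℝ] ℝ),
    (∀ k, 0 < ε k) ∧ Antitone ε ∧ Tendsto ε atTop (nhds 0) ∧
    Tendsto x atTop (nhds xb) ∧ Tendsto (fun k => g (x k)) atTop (nhds (g xb)) ∧
    (∀ k, u k ∈ geomSub (ε k) g (x k)) ∧ WeakStarTendsto u xs}

/-- `f` is lower semicontinuous relative to `Ω` at `xb`. -/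
def LscRelAt (f : X → EReal) (Ω : Set X) (xb : X) : Prop :=
  f xb ≤ Filter.liminf f (nhdsWithin xb Ω)

/-- `f` is lower semicontinuous relative to `Ω` (at every point of `Ω ∩ dom f`). -/
def LscRelOn (f : X → EReal) (Ω : Set X) : Prop :=
  ∀ x ∈ Ω, f x ≠ ⊤ → LscRelAt f Ω x

/-- `f` is lower semicontinuous relative to `Ω` around `xb`. -/
def LscRelAround (f : X → EReal) (Ω : Set X) (xb : X) : Prop :=
  ∃ U ∈ 𝓝 xb, ∀ x ∈ U ∩ Ω, f x ≠ ⊤ → LscRelAt f Ω x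

/-- `f` is locally Lipschitz relative to `Ω` around `xb` with modulus `ℓ`. -/
def LocLipRel (f : X → EReal) (Ω : Set X) (xb : X) (ℓ : ℝ) : Prop :=
  ∃ U ∈ 𝓝 xb, (∀ x ∈ U ∩ Ω, ∃ r : ℝ, f x = (r : EReal)) ∧
    ∀ x ∈ U ∩ Ω, ∀ u ∈ U ∩ Ω, |(f x).toReal - (f u).toReal| ≤ ℓ * ‖x - u‖

/-- A set is locally closed around a point. -/
def LocallyClosedAt {E : Type*} [MetricSpace E] (S : Set E) (p : E) : Prop :=
  ∃ r : ℝ, 0 < r ∧ IsClosed (S ∩ Metric.closedBall p r)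

/-- `f` is (finite and) continuous relative to `Ω`. -/
def ContRelOn (f : X → EReal) (Ω : Set X) : Prop :=
  (∀ x ∈ Ω, ∃ r : ℝ, f x = (r : EReal)) ∧
  ∀ x ∈ Ω, Tendsto f (nhdsWithin x Ω) (nhds (f x))

/-- `f` is convex on the set `S`. -/
def ConvexOnSet (f : X → EReal) (S : Set X) : Prop :=
  ∀ x ∈ S, ∀ y ∈ S, ∀ t : ℝ, 0 ≤ t → t ≤ 1 →
    f (t • x + (1 - t) • y) ≤ (t : EReal) * f x + ((1 - t : ℝ) : EReal) * f y

/-- Monotonicity of a set-valued map from `X` into `X*`. -/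
def MonotoneSV (F : X → Set (X →L[ℝ] ℝ)) : Prop :=
  ∀ x u : X, ∀ xs us : X →L[ℝ] ℝ, xs ∈ F x → us ∈ F u → 0 ≤ (xs - us) (x - u)

end NormedX

end




namespace RLS

lemma ekeland {E : Type*} [MetricSpace E] [CompleteSpace E] (K : Set E) (hK : IsClosed K)
    (h : E → ℝ) (hc : ContinuousOn h K) (m : ℝ) (hm : ∀ z ∈ K, m ≤ h z) (z0 : E) (hz0 : z0 ∈ K)
    (τ : ℝ) (hτ : 0 < τ) :
    ∃ y ∈ K, h y + τ * dist y z0 ≤ h z0 ∧ ∀ z ∈ K, h y ≤ h z + τ * dist z y := by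
  have hex : ∀ y : K, ∀ n : ℕ, ∃ y' : K, h y' + τ * dist (y' : E) y ≤ h y ∧
      ∀ z ∈ K, h z + τ * dist z y ≤ h y → h y' ≤ h z + 1 / ((n : ℝ) + 1) := by
    intro y n
    set A : Set ℝ := h '' {z | z ∈ K ∧ h z + τ * dist z y ≤ h y} with hA
    have hne : A.Nonempty := ⟨h y, y, ⟨y.2, by simp⟩, rfl⟩
    have hbd : BddBelow A := ⟨m, by rintro _ ⟨z, hz, rfl⟩; exact hm z hz.1⟩
    have hpos : (0:ℝ) < 1 / ((n : ℝ) + 1) := by positivity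
    obtain ⟨_, ⟨z, hz, rfl⟩, hlt⟩ := Real.lt_sInf_add_pos hne hpos
    refine ⟨⟨z, hz.1⟩, hz.2, fun w hw hw2 => ?_⟩
    have : sInf A ≤ h w := csInf_le hbd ⟨w, ⟨hw, hw2⟩, rfl⟩
    simp only
    linarith
  choose nx hnx1 hnx2 using hex
  let u : ℕ → K := fun n => Nat.rec ⟨z0, hz0⟩ (fun n y => nx y n) n
  have hu : ∀ n, u (n + 1) = nx (u n) n := fun n => rfl
  have hu0 : u 0 = ⟨z0, hz0⟩ := rfl
  clear_value u
  have hstep : ∀ n k : ℕ, h (u (n + k) : E) + τ * dist (u (n + k) : E) (u n) ≤ h (u n : E) := by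
    intro n k
    induction k with
    | zero => simp
    | succ k ih =>
      have h1 := hnx1 (u (n + k)) (n + k)
      rw [← hu] at h1
      have h2 := dist_triangle (u (n + k + 1) : E) (u (n + k)) (u n)
      have h3 := mul_le_mul_of_nonneg_left h2 hτ.le
      rw [← add_assoc]
      linarith
  have hanti : Antitone (fun n : ℕ => h (u n : E)) := by
    apply antitone_nat_of_succ_le
    intro n
    have := hstep n 1
    have h2 : 0 ≤ τ * dist (u (n + 1) : E) (u n) := by positivity
    linarith
  have hlim := tendsto_atTop_ciInf hanti ⟨m, by rintro _ ⟨n, rfl⟩; exact hm _ (u n).2⟩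
  have hcauchy : CauchySeq (fun n => (u n : E)) := by
    have hc1 := hlim.cauchySeq
    rw [Metric.cauchySeq_iff'] at hc1 ⊢
    intro e he
    obtain ⟨N, hN⟩ := hc1 (τ * e) (by positivity)
    refine ⟨N, fun n hn => ?_⟩
    have h1 := hN n hn
    obtain ⟨k, rfl⟩ := Nat.exists_eq_add_of_le hn
    have h2 := hstep N k
    rw [Real.dist_eq, abs_lt] at h1
    have : τ * dist (u (N + k) : E) (u N) < τ * e := by linarith [h1.1]
    exact lt_of_mul_lt_mul_left this hτ.le
  obtain ⟨y, hy⟩ := cauchySeq_tendsto_of_complete hcauchy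
  have hyK : y ∈ K := hK.mem_of_tendsto hy (Eventually.of_forall fun n => (u n).2)
  have hhy : Tendsto (fun n => h (u n : E)) atTop (𝓝 (h y)) := by
    have h1 := hc y hyK
    exact h1.tendsto.comp (tendsto_nhdsWithin_iff.2 ⟨hy, Eventually.of_forall fun n => (u n).2⟩)
  have hS : ∀ n : ℕ, h y + τ * dist y (u n) ≤ h (u n : E) := by
    intro n
    have h1 : Tendsto (fun m => h (u m : E) + τ * dist (u m : E) (u n)) atTop
        (𝓝 (h y + τ * dist y (u n))) :=
      hhy.add ((hy.dist tendsto_const_nhds).const_mul τ)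
    refine le_of_tendsto h1 (eventually_atTop.2 ⟨n, fun m hm => ?_⟩)
    obtain ⟨k, rfl⟩ := Nat.exists_eq_add_of_le hm
    exact hstep n k
  refine ⟨y, hyK, by simpa only [hu0] using hS 0, fun z hz => ?_⟩
  by_contra hcon
  push Not at hcon
  have h1 : ∀ n : ℕ, h y ≤ h z + 1 / ((n : ℝ) + 1) := by
    intro n
    have h2 := hnx2 (u n) n z hz (by
      have h3 := dist_triangle z y (u n)
      have h4 := mul_le_mul_of_nonneg_left h3 hτ.le
      have := hS n
      linarith)
    rw [← hu] at h2
    have h5 := hS (n + 1)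
    have : 0 ≤ τ * dist y (u (n + 1)) := by positivity
    linarith
  have h2 : h y ≤ h z + 0 :=
    ge_of_tendsto (tendsto_const_nhds.add tendsto_one_div_add_atTop_nhds_zero_nat)
      (Eventually.of_forall h1)
  have : 0 ≤ τ * dist z y := by positivity
  linarith

end RLS


namespace RLS

lemma luc_ext {E : Type*} [NormedAddCommGroup E] [NormedSpace ℝ E] (hE : LocUnifConvex E)
    (x : E) (hx : ‖x‖ = 1) (e : ℝ) (he : 0 < e) :
    ∃ δ : ℝ, 0 < δ ∧ ∀ y : E, ‖y‖ ≤ 1 + δ → 2 - δ < ‖x + y‖ → ‖x - y‖ < e := by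
  obtain ⟨δ0, hδ0, H⟩ := hE x hx (e / 2) (by positivity)
  refine ⟨min (δ0 / 4) (min (e / 4) (1 / 4)), by positivity, fun y hy1 hy2 => ?_⟩
  set δ := min (δ0 / 4) (min (e / 4) (1 / 4)) with hδ
  have h1 : δ ≤ δ0 / 4 := min_le_left _ _
  have h2 : δ ≤ e / 4 := (min_le_right _ _).trans (min_le_left _ _)
  have h3 : δ ≤ 1 / 4 := (min_le_right _ _).trans (min_le_right _ _)
  have h4 := norm_add_le x y
  have h5 : 0 < ‖y‖ := by linarith
  set y' := ‖y‖⁻¹ • y with hy'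
  have h6 : ‖y'‖ = 1 := by
    rw [hy', norm_smul, norm_inv, norm_norm, inv_mul_cancel₀ h5.ne']
  have h7 : ‖y - y'‖ ≤ δ := by
    have : y - y' = (‖y‖ - 1) • y' := by
      rw [sub_smul, hy', smul_smul, mul_inv_cancel₀ h5.ne', one_smul, one_smul]
    rw [this, norm_smul, h6, mul_one, Real.norm_eq_abs, abs_le]
    constructor <;> linarith
  have h8 : ‖x + y‖ ≤ ‖x + y'‖ + ‖y - y'‖ := by
    have : x + y = (x + y') + (y - y') := by abel
    rw [this]; exact norm_add_le _ _
  have h9 := H y' h6 (by linarith)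
  have h10 : ‖x - y‖ ≤ ‖x - y'‖ + ‖y - y'‖ := by
    have : x - y = (x - y') - (y - y') := by abel
    rw [this]; exact norm_sub_le _ _
  linarith

section
variable {X : Type*} [NormedAddCommGroup X] [NormedSpace ℝ X]

lemma exists_norming (hr : Function.Surjective (⇑(NormedSpace.inclusionInDoubleDual ℝ X)))
    (g : X →L[ℝ] ℝ) (hg : g ≠ 0) : ∃ x : X, ‖x‖ = 1 ∧ g x = ‖g‖ := by
  obtain ⟨G, hG1, hG2⟩ := exists_dual_vector ℝ g (norm_ne_zero_iff.2 hg)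
  obtain ⟨x, rfl⟩ := hr G
  refine ⟨x, ?_, ?_⟩
  · have := (NormedSpace.inclusionInDoubleDualLi ℝ (E := X)).norm_map x
    rw [← this]; exact hG1
  · simpa using hG2

lemma dual_smooth (hr : Function.Surjective (⇑(NormedSpace.inclusionInDoubleDual ℝ X)))
    (hL : LocUnifConvex X) (g : X →L[ℝ] ℝ) (hg : g ≠ 0) :
    ∃ x0 : X, ‖x0‖ = 1 ∧ ∀ e > (0:ℝ), ∃ ν > (0:ℝ), ∀ h : X →L[ℝ] ℝ, ‖h‖ ≤ ν →
      ‖g + h‖ ≤ ‖g‖ + h x0 + e * ‖h‖ := by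
  obtain ⟨x0, hx0, hgx⟩ := exists_norming hr g hg
  refine ⟨x0, hx0, fun e he => ?_⟩
  obtain ⟨δ, hδ, H⟩ := hL x0 hx0 e he
  have hgp : 0 < ‖g‖ := norm_pos_iff.2 hg
  refine ⟨min (‖g‖ / 2) (‖g‖ * δ / 4), by positivity, fun h hh => ?_⟩
  have h1 : ‖h‖ ≤ ‖g‖ / 2 := hh.trans (min_le_left _ _)
  have h2 : ‖h‖ ≤ ‖g‖ * δ / 4 := hh.trans (min_le_right _ _)
  have h3 : ‖g‖ ≤ ‖g + h‖ + ‖h‖ := by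
    have := norm_sub_le (g + h) h
    simpa using this
  have hgh : g + h ≠ 0 := by
    intro h0
    rw [h0, norm_zero] at h3
    linarith
  obtain ⟨x, hx, hgx2⟩ := exists_norming hr (g + h) hgh
  have h4 : (g + h) x = g x + h x := rfl
  have h5 : h x ≤ ‖h‖ := by
    have := (le_abs_self _).trans (h.le_opNorm x)
    rwa [hx, mul_one] at this
  have h6 : g (x0 + x) ≤ ‖g‖ * ‖x0 + x‖ := (le_abs_self _).trans (g.le_opNorm _)
  rw [map_add] at h6
  have h7 : ‖x0 - x‖ < e := by
    apply H x hx
    have : ‖g‖ * (2 - δ) < ‖g‖ * ‖x0 + x‖ := by nlinarith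
    exact lt_of_mul_lt_mul_left this hgp.le
  have h8 : g x ≤ ‖g‖ := by
    have := (le_abs_self _).trans (g.le_opNorm x)
    rwa [hx, mul_one] at this
  have h9 : h (x - x0) ≤ ‖h‖ * ‖x - x0‖ := (le_abs_self _).trans (h.le_opNorm _)
  rw [map_sub, norm_sub_rev] at h9
  have h10 : ‖h‖ * ‖x0 - x‖ ≤ ‖h‖ * e := mul_le_mul_of_nonneg_left h7.le (norm_nonneg _)
  linarith

lemma norm_le_of_dual_local (x : X) (C ν : ℝ) (hC : 0 ≤ C) (hν : 0 < ν)
    (h : ∀ η : X →L[ℝ] ℝ, ‖η‖ ≤ ν → η x ≤ C * ‖η‖) : ‖x‖ ≤ C := by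
  by_cases hx : x = 0
  · simpa [hx] using hC
  obtain ⟨g, hg1, hg2⟩ := exists_dual_vector ℝ x (norm_ne_zero_iff.2 hx)
  have := h (ν • g) (by rw [norm_smul, hg1, Real.norm_eq_abs, abs_of_pos hν, mul_one])
  rw [norm_smul, hg1, Real.norm_eq_abs, abs_of_pos hν, mul_one] at this
  simp [hg2] at this
  rw [mul_comm] at this
  exact le_of_mul_le_mul_right this hν

lemma subdiff_exists [CompleteSpace X]
    (hr : Function.Surjective (⇑(NormedSpace.inclusionInDoubleDual ℝ X)))
    (hL : LocUnifConvex X) (s : (X →L[ℝ] ℝ) → ℝ) (hs : ∀ a b, s a - s b ≤ ‖a - b‖)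
    (hs0 : ∀ a, 0 ≤ s a) (φ : X →L[ℝ] ℝ) (κ e : ℝ) (hκ : 0 < κ) (he : 0 < e) :
    ∃ (ψ : X →L[ℝ] ℝ) (x : X) (ν : ℝ), 0 < ν ∧ ‖ψ - φ‖ ≤ κ ∧ ‖x‖ ≤ 1 + e ∧
      ∀ η : X →L[ℝ] ℝ, ‖η‖ ≤ ν → s ψ + η x - e * ‖η‖ ≤ s (ψ + η) := by
  suffices H : ∃ (ψ : X →L[ℝ] ℝ) (x : X) (ν : ℝ), 0 < ν ∧ ‖ψ - φ‖ ≤ κ ∧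
      ∀ η : X →L[ℝ] ℝ, ‖η‖ ≤ ν → s ψ + η x - e * ‖η‖ ≤ s (ψ + η) by
    obtain ⟨ψ, x, ν, hν, h1, h2⟩ := H
    refine ⟨ψ, x, ν, hν, h1, ?_, h2⟩
    refine norm_le_of_dual_local x (1 + e) ν (by positivity) hν fun η hη => ?_
    have h3 := h2 η hη
    have h4 := hs (ψ + η) ψ
    simp only [add_sub_cancel_left] at h4
    linarith
  have hsc : Continuous s := by
    have : LipschitzWith 1 s := by
      apply LipschitzWith.of_dist_le_mul
      intro a b
      rw [Real.dist_eq, dist_eq_norm, abs_le]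
      have h1 := hs a b
      have h2 := hs b a
      rw [norm_sub_rev] at h2
      simp
      constructor <;> linarith
    exact this.continuous
  set A := 1 / κ with hA
  have hAp : 0 < A := by positivity
  obtain ⟨ψ, -, h1, h2⟩ := ekeland (Set.univ : Set (X →L[ℝ] ℝ)) isClosed_univ
    (fun ψ => s ψ + A * ‖ψ - φ‖ ^ 2) (by fun_prop) 0
    (fun z _ => by have := hs0 z; positivity) φ (mem_univ _) (e / 2) (by positivity)
  simp only [sub_self, norm_zero, dist_eq_norm] at h1 h2
  have hAb : A * ‖ψ - φ‖ ≤ 1 := by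
    by_cases h0 : ‖ψ - φ‖ = 0
    · rw [h0]; simp
    have hp : 0 < ‖ψ - φ‖ := lt_of_le_of_ne (norm_nonneg _) (Ne.symm h0)
    have h3 := hs φ ψ
    rw [norm_sub_rev] at h3
    have : (A * ‖ψ - φ‖) * ‖ψ - φ‖ ≤ 1 * ‖ψ - φ‖ := by nlinarith
    exact le_of_mul_le_mul_right this hp
  have hb : ‖ψ - φ‖ ≤ κ := by
    rw [hA, div_mul_eq_mul_div, one_mul, div_le_one hκ] at hAb
    exact hAb
  have h3 : ∀ η : X →L[ℝ] ℝ, s ψ + A * ‖ψ - φ‖ ^ 2 ≤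
      s (ψ + η) + A * ‖(ψ - φ) + η‖ ^ 2 + e / 2 * ‖η‖ := by
    intro η
    have := h2 (ψ + η) (mem_univ _)
    simpa [add_sub_right_comm] using this
  by_cases hg : ψ - φ = 0
  · refine ⟨ψ, 0, e / (2 * A), by positivity, hb, fun η hη => ?_⟩
    have h4 := h3 η
    rw [hg] at h4
    simp at h4 ⊢
    have h5 : A * ‖η‖ ≤ e / 2 := by
      calc A * ‖η‖ ≤ A * (e / (2 * A)) := by gcongr
        _ = e / 2 := by field_simp
    nlinarith [norm_nonneg η]
  · obtain ⟨x0, hx0, H⟩ := dual_smooth hr hL _ hg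
    obtain ⟨ν, hν, H⟩ := H (e / 8) (by positivity)
    refine ⟨ψ, -((2 * A * ‖ψ - φ‖) • x0), min ν (e / (4 * A)), by positivity, hb,
      fun η hη => ?_⟩
    have h4 := h3 η
    have h5 := H η (hη.trans (min_le_left _ _))
    have h6 : A * ‖η‖ ≤ e / 4 := by
      calc A * ‖η‖ ≤ A * (e / (4 * A)) := by gcongr; exact hη.trans (min_le_right _ _)
        _ = e / 4 := by field_simp
    rw [map_neg, map_smul, smul_eq_mul]
    set b := ‖ψ - φ‖
    set a := ‖ψ - φ + η‖
    have hb0 : 0 ≤ b := norm_nonneg _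
    have h7 : |a - b| ≤ ‖η‖ := by
      have := abs_norm_sub_norm_le (ψ - φ + η) (ψ - φ)
      simpa using this
    have h8 : (a - b) ^ 2 ≤ ‖η‖ ^ 2 := by
      rw [← sq_abs (a - b)]; gcongr
    have h9 : A * (a ^ 2 - b ^ 2) ≤ 2 * A * b * (η x0) + (e / 4) * ‖η‖ + (e / 4) * ‖η‖ := by
      have e1 : A * (a ^ 2 - b ^ 2) = 2 * (A * b) * (a - b) + A * (a - b) ^ 2 := by ring
      rw [e1]
      have e2 : 2 * (A * b) * (a - b) ≤ 2 * (A * b) * (η x0 + e / 8 * ‖η‖) := by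
        gcongr
        linarith
      have e3 : A * (a - b) ^ 2 ≤ (e / 4) * ‖η‖ := by
        calc A * (a - b) ^ 2 ≤ A * ‖η‖ ^ 2 := by gcongr
          _ = (A * ‖η‖) * ‖η‖ := by ring
          _ ≤ _ := by gcongr
      have e4 : 2 * (A * b) * (e / 8 * ‖η‖) ≤ 2 * 1 * (e / 8 * ‖η‖) := by gcongr
      nlinarith
    linarith
end
end RLS


namespace RLS

structure St (X : Type*) [NormedAddCommGroup X] [NormedSpace ℝ X] where
  y : X
  p : X →L[ℝ] ℝ
  τ : ℝ
  b : ℝ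

section
variable {X : Type*} [NormedAddCommGroup X] [NormedSpace ℝ X]

def Valid (K : Set X) (F : X → ℝ) (x0 : X) (R : ℝ) (S : St X) : Prop :=
  S.y ∈ K ∧ 0 < S.τ ∧ 0 < S.b ∧ ‖S.y - x0‖ + S.b ≤ R ∧
    ∀ z ∈ K, ‖z - S.y‖ ≤ S.b → F S.y + S.p (z - S.y) - S.τ * ‖z - S.y‖ ≤ F z

noncomputable def val (S : St X) (ψ : X →L[ℝ] ℝ) : ℝ := ‖S.p - ψ‖ + S.τ

def HB (K : Set X) (F : X → ℝ) (x0 : X) (R ε : ℝ) : Prop :=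
  ∀ x ∈ K, ‖x - x0‖ ≤ R → ∀ r > (0:ℝ), ∃ z ∈ K, ‖z - x‖ ≤ r ∧ F z < F x - ε * ‖z - x‖

def StepR (K : Set X) (F : X → ℝ) (x0 : X) (R : ℝ) (φ : X →L[ℝ] ℝ) (η : ℝ) (S S' : St X) : Prop :=
  Valid K F x0 R S' ∧ 0 < ‖S'.y - S.y‖ ∧ ‖S'.y - S.y‖ ≤ η * S.b ∧ S'.b ≤ ‖S'.y - S.y‖ ∧
  S'.τ ≤ η ∧ ∃ (j : X →L[ℝ] ℝ) (k : ℝ), 0 ≤ k ∧ ‖j‖ ≤ 1 ∧ j (S'.y - S.y) = ‖S'.y - S.y‖ ∧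
    S'.p = φ - k • j ∧
    k * ‖S'.y - S.y‖ ≤ (1 + η) * ((F S.y - φ S.y) - (F S'.y - φ S'.y)) ∧
    ∀ z ∈ K, ‖z - S.y‖ ≤ S.b →
      F S'.y - φ S'.y - k / (2 * ‖S'.y - S.y‖) * (‖z - S.y‖ ^ 2 - ‖S'.y - S.y‖ ^ 2)
        - S'.τ * ‖z - S'.y‖ ≤ F z - φ z

lemma val_gt {K : Set X} {F : X → ℝ} {x0 : X} {R c : ℝ} (hB : HB K F x0 R (2 * c)) {S : St X}
    (hS : Valid K F x0 R S) {φ : X →L[ℝ] ℝ} (hφ : ‖φ‖ ≤ c) : c < val S φ := by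
  obtain ⟨h1, h2, h3, h4, h5⟩ := hS
  obtain ⟨z, hz, hz1, hz2⟩ := hB S.y h1 (by linarith) S.b h3
  have h6 := h5 z hz hz1
  have hpos : 0 < ‖z - S.y‖ := by
    rcases (norm_nonneg (z - S.y)).eq_or_lt with h0 | h0
    · have : z = S.y := by
        have := h0.symm
        rwa [norm_eq_zero, sub_eq_zero] at this
      rw [this] at hz2
      simp at hz2
    · exact h0
  have h7 : -(‖S.p‖ * ‖z - S.y‖) ≤ S.p (z - S.y) := (abs_le.1 (S.p.le_opNorm (z - S.y))).1
  have h8 : 2 * c < ‖S.p‖ + S.τ := by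
    have : (2 * c) * ‖z - S.y‖ < (‖S.p‖ + S.τ) * ‖z - S.y‖ := by nlinarith
    exact lt_of_mul_lt_mul_right this hpos.le
  have h9 : ‖S.p‖ ≤ ‖S.p - φ‖ + ‖φ‖ := by
    have := norm_add_le (S.p - φ) φ
    simpa using this
  unfold val
  linarith

lemma rpow_ineq {a ρ θ : ℝ} (ha : 0 ≤ a) (hρ : 0 < ρ) (hθ0 : 0 ≤ θ) (hθ1 : θ ≤ 1) :
    a ^ (1 + θ) - ρ ^ (1 + θ) ≤ (1 + θ) * ρ ^ θ / (2 * ρ) * (a ^ 2 - ρ ^ 2) := by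
  have h1 : a ^ (1 + θ) = ρ ^ (1 + θ) * ((1 + ((a / ρ) ^ 2 - 1)) ^ ((1 + θ) / 2)) := by
    have e1 : 1 + ((a / ρ) ^ 2 - 1) = (a / ρ) ^ (2:ℝ) := by
      rw [Real.rpow_two]; ring
    have e2 : (2:ℝ) * ((1 + θ) / 2) = 1 + θ := by ring
    have e3 : ρ * (a / ρ) = a := by field_simp
    rw [e1, ← Real.rpow_mul (by positivity), e2, ← Real.mul_rpow hρ.le (by positivity), e3]
  have h2 := rpow_one_add_le_one_add_mul_self (s := (a / ρ) ^ 2 - 1)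
    (by have : 0 ≤ (a / ρ) ^ 2 := by positivity
        linarith) (p := (1 + θ) / 2) (by linarith) (by linarith)
  have h3 : 0 < ρ ^ (1 + θ) := by positivity
  have h4 := mul_le_mul_of_nonneg_left h2 h3.le
  rw [← h1] at h4
  have h5 : ρ ^ (1 + θ) = ρ * ρ ^ θ := by
    rw [Real.rpow_add hρ, Real.rpow_one]
  have h6 : (1 + θ) * ρ ^ θ / (2 * ρ) * (a ^ 2 - ρ ^ 2) =
      ρ ^ (1 + θ) * ((1 + θ) / 2 * ((a / ρ) ^ 2 - 1)) := by
    rw [h5]; field_simp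
  rw [h6]
  linarith

lemma normdiff {q : X} (hd : DifferentiableAt ℝ (fun y : X => ‖y‖) q) :
    ∃ j : X →L[ℝ] ℝ, ‖j‖ ≤ 1 ∧ j q = ‖q‖ ∧ ∀ e > (0:ℝ), ∃ ν > (0:ℝ), ∀ w : X, ‖w‖ ≤ ν →
      ‖q + w‖ ≤ ‖q‖ + j w + e * ‖w‖ := by
  refine ⟨fderiv ℝ (fun y : X => ‖y‖) q, ?_, ?_, ?_⟩
  · have := norm_fderiv_le_of_lipschitz ℝ (lipschitzWith_one_norm (E := X)) (x₀ := q)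
    simpa using this
  · exact hd.fderiv_norm_self
  · intro e he
    have h1 := hd.hasFDerivAt
    rw [hasFDerivAt_iff_isLittleO_nhds_zero] at h1
    have h2 := h1.def he
    rw [Metric.eventually_nhds_iff] at h2
    obtain ⟨ν, hν, H⟩ := h2
    refine ⟨ν / 2, by positivity, fun w hw => ?_⟩
    have := H (y := w) (by rw [dist_zero_right]; linarith)
    have := (abs_le.1 this).2
    linarith
end
end RLS


namespace RLS
section
variable {X : Type*} [NormedAddCommGroup X] [NormedSpace ℝ X]

set_option maxHeartbeats 1000000 in
lemma step_exists [CompleteSpace X]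
    (hd : ∀ x : X, x ≠ 0 → DifferentiableAt ℝ (fun y : X => ‖y‖) x)
    {K : Set X} (hK : IsClosed K) {F : X → ℝ} (hF : ContinuousOn F K) {x0 : X} {R c : ℝ}
    (hc : 0 < c) (hB : HB K F x0 R (2 * c)) {S : St X} (hS : Valid K F x0 R S)
    {φ : X →L[ℝ] ℝ} (hφ : ‖φ‖ ≤ c) {η γ : ℝ} (hη : 0 < η) (hη2 : η ≤ 1 / 2) (hγ : 0 < γ) :
    ∃ S', StepR K F x0 R φ η S S' ∧ val S' φ ≤ val S φ + γ := by
  have hv := val_gt hB hS hφ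
  obtain ⟨hyK, hτ, hb, hyR, hsub⟩ := hS
  obtain ⟨v, hvdef⟩ : ∃ v, v = val S φ := ⟨_, rfl⟩
  rw [← hvdef] at hv ⊢
  have hv0 : 0 < v := hc.trans hv
  obtain ⟨y, p, τ, b⟩ := S
  simp only at *
  -- lower bound
  have hlow : ∀ z ∈ K, ‖z - y‖ ≤ b → -(v * ‖z - y‖) ≤ (F z - φ z) - (F y - φ y) := by
    intro z hz hzb
    have h1 := hsub z hz hzb
    have h2 := (abs_le.1 ((p - φ).le_opNorm (z - y))).1
    have h3 : (p - φ) (z - y) = p (z - y) - (φ z - φ y) := by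
      simp
    rw [h3] at h2
    have h4 : v * ‖z - y‖ = ‖p - φ‖ * ‖z - y‖ + τ * ‖z - y‖ := by rw [hvdef, val]; ring
    linarith
  obtain ⟨θ, hθ0, hθη, hθv⟩ : ∃ θ, 0 < θ ∧ θ ≤ η ∧ (1 + θ) * v ≤ v + γ / 2 := by
    refine ⟨min η (γ / (2 * v)), by positivity, min_le_left _ _, ?_⟩
    have : min η (γ / (2 * v)) * v ≤ γ / (2 * v) * v := by gcongr; exact min_le_right _ _
    have e : γ / (2 * v) * v = γ / 2 := by field_simp
    linarith
  obtain ⟨τ', hτ'0, hτ'η, hτ'γ⟩ : ∃ τ', 0 < τ' ∧ τ' ≤ η ∧ τ' ≤ γ / 2 :=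
    ⟨min η (γ / 2), by positivity, min_le_left _ _, min_le_right _ _⟩
  have hηb : 0 < η * b := by positivity
  obtain ⟨lam, hlam0, hlam⟩ : ∃ lam, 0 < lam ∧ lam * (η * b) ^ θ = v + 1 := by
    have h1 : 0 < (η * b) ^ θ := by positivity
    exact ⟨(v + 1) / (η * b) ^ θ, by positivity, by field_simp⟩
  let h : X → ℝ := fun z => (F z - φ z) - (F y - φ y) + lam * ‖z - y‖ ^ (1 + θ)
  have hsplit : ∀ t : ℝ, 0 < t → t ^ (1 + θ) = t * t ^ θ := by
    intro t ht
    rw [Real.rpow_add ht, Real.rpow_one]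
  -- starting point
  obtain ⟨z0, hz0K, hz0b, hz0h⟩ : ∃ z0 ∈ K, ‖z0 - y‖ ≤ b ∧ h z0 < 0 := by
    have hrp : 0 < (c / lam) ^ (1 / θ) := by positivity
    obtain ⟨z, hz, hz1, hz2⟩ := hB y hyK (by linarith) (min b ((c / lam) ^ (1 / θ)))
      (by positivity)
    refine ⟨z, hz, hz1.trans (min_le_left _ _), ?_⟩
    have hpos : 0 < ‖z - y‖ := by
      rcases (norm_nonneg (z - y)).eq_or_lt with h0 | h0
      · have : z = y := by
          have := h0.symm
          rwa [norm_eq_zero, sub_eq_zero] at this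
        rw [this] at hz2
        simp at hz2
      · exact h0
    have h1 : ‖z - y‖ ^ θ ≤ c / lam := by
      calc ‖z - y‖ ^ θ ≤ ((c / lam) ^ (1 / θ)) ^ θ := by
            apply Real.rpow_le_rpow hpos.le (hz1.trans (min_le_right _ _)) hθ0.le
        _ = c / lam := by
            rw [← Real.rpow_mul (by positivity)]
            have : 1 / θ * θ = 1 := by field_simp
            rw [this, Real.rpow_one]
    have h2 : lam * ‖z - y‖ ^ (1 + θ) ≤ c * ‖z - y‖ := by
      rw [hsplit _ hpos]
      have : lam * ‖z - y‖ ^ θ ≤ c := by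
        calc lam * ‖z - y‖ ^ θ ≤ lam * (c / lam) := by gcongr
          _ = c := by field_simp
      nlinarith
    have h3 := (abs_le.1 (φ.le_opNorm (z - y))).1
    rw [map_sub] at h3
    have h4 : ‖φ‖ * ‖z - y‖ ≤ c * ‖z - y‖ := by gcongr
    simp only [h]
    linarith
  -- Ekeland
  obtain ⟨y', ⟨hy'K, hy'b⟩, hek1, hek2⟩ := ekeland (K ∩ Metric.closedBall y b)
    (hK.inter Metric.isClosed_closedBall) h
    (by
      have h1 : ContinuousOn F (K ∩ Metric.closedBall y b) := hF.mono inter_subset_left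
      have h2 : Continuous (fun z : X => ‖z - y‖ ^ (1 + θ)) := by
        apply Continuous.rpow_const (by fun_prop)
        intro x; right; linarith
      exact ((h1.sub φ.continuous.continuousOn).sub continuousOn_const).add
        (continuousOn_const.mul h2.continuousOn)) (-(v * b))
    (by
      rintro z ⟨hz, hzb⟩
      rw [mem_closedBall_iff_norm] at hzb
      have h1 := hlow z hz hzb
      have h2 : v * ‖z - y‖ ≤ v * b := by gcongr
      have h3 : 0 ≤ lam * ‖z - y‖ ^ (1 + θ) := by positivity
      simp only [h]
      linarith) z0 ⟨hz0K, by rwa [mem_closedBall_iff_norm]⟩ (τ' / 2) (by positivity)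
  rw [mem_closedBall_iff_norm] at hy'b
  have hy'h : h y' < 0 := by
    have : 0 ≤ τ' / 2 * dist y' z0 := by positivity
    linarith
  have hρ0 : 0 < ‖y' - y‖ := by
    rcases (norm_nonneg (y' - y)).eq_or_lt with h0 | h0
    · exfalso
      have h1 := hlow y' hy'K hy'b
      have h2 : 0 ≤ lam * ‖y' - y‖ ^ (1 + θ) := by positivity
      rw [← h0] at h1
      simp only [h] at hy'h
      linarith
    · exact h0
  obtain ⟨ρ, hρ⟩ : ∃ ρ, ρ = ‖y' - y‖ := ⟨_, rfl⟩
  have hhy' : h y' = (F y' - φ y') - (F y - φ y) + lam * ρ ^ (1 + θ) := by simp only [h, hρ]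
  rw [← hρ] at hρ0 hy'b
  have hlr : lam * ρ ^ θ < v := by
    have h1 := hlow y' hy'K (by rw [← hρ]; exact hy'b)
    rw [← hρ] at h1
    rw [hhy', hsplit _ hρ0] at hy'h
    have : (lam * ρ ^ θ) * ρ < v * ρ := by linarith
    exact lt_of_mul_lt_mul_right this hρ0.le
  have hρη : ρ < η * b := by
    by_contra hcon
    push Not at hcon
    have h1 : (η * b) ^ θ ≤ ρ ^ θ := Real.rpow_le_rpow hηb.le hcon hθ0.le
    have h2 : lam * (η * b) ^ θ ≤ lam * ρ ^ θ := by gcongr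
    linarith
  obtain ⟨k, hk⟩ : ∃ k, k = (1 + θ) * (lam * ρ ^ θ) := ⟨_, rfl⟩
  have hk0 : 0 ≤ k := by rw [hk]; positivity
  have hkv : k ≤ v + γ / 2 := by
    rw [hk]
    have : (1 + θ) * (lam * ρ ^ θ) ≤ (1 + θ) * v := by gcongr
    linarith
  have hkρ : k * ρ ≤ (1 + η) * ((F y - φ y) - (F y' - φ y')) := by
    have h1 : lam * ρ ^ (1 + θ) ≤ (F y - φ y) - (F y' - φ y') := by
      rw [hhy'] at hy'h; linarith
    have h2 : 0 ≤ lam * ρ ^ (1 + θ) := by positivity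
    have h3 : k * ρ = (1 + θ) * (lam * ρ ^ (1 + θ)) := by
      rw [hsplit _ hρ0, hk]; ring
    rw [h3]
    gcongr
  -- (I')
  have hI : ∀ z ∈ K, ‖z - y‖ ≤ b →
      F y' - φ y' - k / (2 * ρ) * (‖z - y‖ ^ 2 - ρ ^ 2) - τ' / 2 * ‖z - y'‖ ≤ F z - φ z := by
    intro z hz hzb
    have h1 := hek2 z ⟨hz, by rwa [mem_closedBall_iff_norm]⟩
    rw [hhy', dist_eq_norm] at h1
    simp only [h] at h1
    have h2 := rpow_ineq (norm_nonneg (z - y)) hρ0 hθ0.le (by linarith : θ ≤ 1)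
    have h3 := mul_le_mul_of_nonneg_left h2 hlam0.le
    have h4 : lam * ((1 + θ) * ρ ^ θ / (2 * ρ) * (‖z - y‖ ^ 2 - ρ ^ 2)) =
        k / (2 * ρ) * (‖z - y‖ ^ 2 - ρ ^ 2) := by rw [hk]; ring
    rw [h4] at h3
    linarith
  have hq : y' - y ≠ 0 := by
    intro h0; rw [h0, norm_zero] at hρ; linarith
  obtain ⟨j, hj1, hj2, hj3⟩ := normdiff (hd _ hq)
  obtain ⟨ν, hν, hj3⟩ := hj3 (τ' / (4 * (k + 1))) (by positivity)
  rw [← hρ] at hj2 hj3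
  have hbρ : 0 < b - ρ := by nlinarith
  obtain ⟨b', hb'0, hb'1, hb'2, hb'3, hb'4⟩ : ∃ b', 0 < b' ∧ b' ≤ ν ∧ b' ≤ ρ ∧ b' ≤ b - ρ ∧
      k / (2 * ρ) * b' ≤ τ' / 4 := by
    refine ⟨min (min ν ρ) (min (b - ρ) (τ' * ρ / (2 * (k + 1)))), by positivity,
      (min_le_left _ _).trans (min_le_left _ _), (min_le_left _ _).trans (min_le_right _ _),
      (min_le_right _ _).trans (min_le_left _ _), ?_⟩
    calc _ ≤ k / (2 * ρ) * (τ' * ρ / (2 * (k + 1))) := by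
          gcongr; exact (min_le_right _ _).trans (min_le_right _ _)
      _ = τ' / 4 * (k / (k + 1)) := by field_simp; ring
      _ ≤ τ' / 4 * 1 := by
          gcongr
          rw [div_le_one (by positivity)]; linarith
      _ = _ := by ring
  have htri : ∀ z, ‖z - y‖ ≤ ‖z - y'‖ + ρ := by
    intro z
    have := norm_add_le (z - y') (y' - y)
    rw [hρ]; simpa using this
  refine ⟨⟨y', φ - k • j, τ', b'⟩, ⟨⟨hy'K, hτ'0, hb'0, ?_, ?_⟩, ?_, ?_, ?_, hτ'η, j, k, hk0, hj1, ?_, rfl, ?_, ?_⟩, ?_⟩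
  · have := norm_add_le (y' - y) (y - x0)
    rw [← hρ, sub_add_sub_cancel] at this
    simp only
    linarith
  · intro z hz hzb
    simp only at hzb ⊢
    have h1 := hI z hz (by have := htri z; linarith)
    have h2 := hj3 (z - y') (hzb.trans hb'1)
    have h3 : y' - y + (z - y') = z - y := by abel
    rw [h3] at h2
    have h4 : |‖z - y‖ - ρ| ≤ ‖z - y'‖ := by
      have := abs_norm_sub_norm_le (z - y) (y' - y)
      rwa [sub_sub_sub_cancel_right, ← hρ] at this
    have h5 : (‖z - y‖ - ρ) ^ 2 ≤ ‖z - y'‖ ^ 2 := by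
      rw [← sq_abs (‖z - y‖ - ρ)]; gcongr
    set w := ‖z - y'‖
    have hw0 : 0 ≤ w := norm_nonneg _
    have h6 : k / (2 * ρ) * (‖z - y‖ ^ 2 - ρ ^ 2) =
        k * (‖z - y‖ - ρ) + k / (2 * ρ) * (‖z - y‖ - ρ) ^ 2 := by
      field_simp; ring
    have h7 : k * (‖z - y‖ - ρ) ≤ k * (j (z - y') + τ' / (4 * (k + 1)) * w) := by
      gcongr; linarith
    have h8 : k * (τ' / (4 * (k + 1)) * w) ≤ τ' / 4 * w := by
      have : k * (τ' / (4 * (k + 1)) * w) = τ' / 4 * w * (k / (k + 1)) := by field_simp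
      rw [this]
      have h9 : k / (k + 1) ≤ 1 := by rw [div_le_one (by positivity)]; linarith
      have : 0 ≤ τ' / 4 * w := by positivity
      nlinarith
    have h9 : k / (2 * ρ) * (‖z - y‖ - ρ) ^ 2 ≤ τ' / 4 * w := by
      calc k / (2 * ρ) * (‖z - y‖ - ρ) ^ 2 ≤ k / (2 * ρ) * w ^ 2 := by gcongr
        _ = (k / (2 * ρ) * w) * w := by ring
        _ ≤ (k / (2 * ρ) * b') * w := by gcongr
        _ ≤ _ := by gcongr
    have h10 : (φ - k • j) (z - y') = φ z - φ y' - k * j (z - y') := by simp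
    rw [h10]
    rw [h6] at h1
    rw [mul_add] at h7
    linarith
  · simp only; rw [← hρ]; exact hρ0
  · simp only; rw [← hρ]; exact hρη.le
  · simp only; rw [← hρ]; exact hb'2
  · simp only; rw [← hρ]; exact hj2
  · simp only; rw [← hρ]; exact hkρ
  · intro z hz hzb
    simp only at hzb ⊢
    rw [← hρ]
    have := hI z hz hzb
    have : 0 ≤ τ' / 2 * ‖z - y'‖ := by positivity
    linarith
  · simp only [val]
    have h1 : φ - k • j - φ = -(k • j) := by abel
    rw [h1, norm_neg, norm_smul, Real.norm_eq_abs, abs_of_nonneg hk0]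
    have : k * ‖j‖ ≤ k * 1 := by gcongr
    linarith
end
end RLS


namespace RLS

structure Stg (X : Type*) [NormedAddCommGroup X] [NormedSpace ℝ X] where
  S : St X
  φ : X →L[ℝ] ℝ
  ω : ℝ

section
variable {X : Type*} [NormedAddCommGroup X] [NormedSpace ℝ X]

def SV (K : Set X) (F : X → ℝ) (x0 : X) (R c : ℝ) (D : Stg X) : Prop :=
  Valid K F x0 R D.S ∧ 0 < D.ω ∧ D.ω ≤ 1 / 2 ∧ ‖D.φ‖ + D.ω ≤ c

def rel (K : Set X) (F : X → ℝ) (x0 : X) (R : ℝ) (D : Stg X) (T T' : St X) : Prop :=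
  ∃ φ' : X →L[ℝ] ℝ, ‖φ' - D.φ‖ ≤ D.ω ∧ StepR K F x0 R φ' D.ω T T' ∧
    val T' D.φ < val D.S D.φ + D.ω

lemma StepR.mono {K : Set X} {F : X → ℝ} {x0 : X} {R : ℝ} {φ : X →L[ℝ] ℝ} {η η' : ℝ}
    {S S' : St X} (hη : 0 < η) (hle : η ≤ η') (h : StepR K F x0 R φ η S S') :
    StepR K F x0 R φ η' S S' := by
  obtain ⟨h1, h2, h3, h4, h5, j, k, hk, hj, hj2, hp, hkr, hI⟩ := h
  have hb : 0 < S.b := by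
    have : 0 < η * S.b := h2.trans_le h3
    exact (pos_iff_pos_of_mul_pos this).1 hη
  refine ⟨h1, h2, h3.trans (by gcongr), h4, h5.trans hle, j, k, hk, hj, hj2, hp, ?_, hI⟩
  refine hkr.trans ?_
  have h6 : 0 ≤ (1 + η) * (F S.y - φ S.y - (F S'.y - φ S'.y)) :=
    le_trans (by positivity) hkr
  have h7 : 0 ≤ F S.y - φ S.y - (F S'.y - φ S'.y) := nonneg_of_mul_nonneg_right h6 (by linarith)
  gcongr

lemma val_le (T : St X) (a b : X →L[ℝ] ℝ) : val T a ≤ val T b + ‖a - b‖ := by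
  unfold val
  have := norm_sub_le (T.p - b) (a - b)
  rw [sub_sub_sub_cancel_right] at this
  linarith

set_option maxHeartbeats 1000000 in
lemma transition [CompleteSpace X] (hX : StandingAssumptions X)
    {K : Set X} (hK : IsClosed K) {F : X → ℝ} (hF : ContinuousOn F K) {x0 : X} {R c : ℝ}
    (hc : 0 < c) (hB : HB K F x0 R (2 * c)) (D : Stg X) (hD : SV K F x0 R c D) :
    ∃ D' : Stg X, SV K F x0 R c D' ∧ Relation.TransGen (rel K F x0 R D) D.S D'.S ∧
      (∀ T T', rel K F x0 R D' T T' → rel K F x0 R D T T') ∧ D'.ω ≤ D.ω / 2 ∧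
      ‖D'.φ - D.φ‖ ≤ D.ω / 2 ∧ ∃ x : X, ‖x‖ ≤ 1 + D.ω ∧
        ∀ T, Relation.ReflTransGen (rel K F x0 R D') D'.S T →
          ‖T.p - D'.φ‖ - D.ω ≤ (D'.φ - T.p) x ∧
          |val T D'.φ - val D'.S D'.φ| ≤ D.ω := by
  obtain ⟨hr, hL, -, hd⟩ := hX
  obtain ⟨S, φ, ω⟩ := D
  obtain ⟨hS, hω, hω2, hφ⟩ := hD
  simp only at *
  set rD := rel K F x0 R ⟨S, φ, ω⟩ with hrD
  have hRv : ∀ T, Relation.ReflTransGen rD S T → Valid K F x0 R T ∧ val T φ < val S φ + ω := by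
    intro T hT
    rcases hT.cases_tail with h0 | ⟨T0, -, h0⟩
    · rw [h0]; exact ⟨hS, by linarith⟩
    · obtain ⟨φ', -, h1, h2⟩ := h0
      exact ⟨h1.1, h2⟩
  let A : (X →L[ℝ] ℝ) → Set ℝ := fun ψ => (fun T => val T ψ) '' {T | Relation.ReflTransGen rD S T}
  let s : (X →L[ℝ] ℝ) → ℝ := fun ψ => sInf (A ψ)
  have hval0 : ∀ T, Relation.ReflTransGen rD S T → ∀ ψ, 0 ≤ val T ψ := by
    intro T hT ψ
    have := (hRv T hT).1.2.1
    unfold val; positivity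
  have hAne : ∀ ψ, (A ψ).Nonempty := fun ψ => ⟨_, S, Relation.ReflTransGen.refl, rfl⟩
  have hAbd : ∀ ψ, BddBelow (A ψ) := fun ψ => ⟨0, by rintro _ ⟨T, hT, rfl⟩; exact hval0 T hT ψ⟩
  have hsle : ∀ ψ T, Relation.ReflTransGen rD S T → s ψ ≤ val T ψ := fun ψ T hT =>
    csInf_le (hAbd ψ) ⟨T, hT, rfl⟩
  have hs0 : ∀ ψ, 0 ≤ s ψ := fun ψ => le_csInf (hAne ψ) (by
    rintro _ ⟨T, hT, rfl⟩; exact hval0 T hT ψ)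
  have hsl : ∀ a b, s a - s b ≤ ‖a - b‖ := by
    intro a b
    have : s a - ‖a - b‖ ≤ s b := le_csInf (hAne b) (by
      rintro _ ⟨T, hT, rfl⟩
      have h1 := hsle a T hT
      have h2 := val_le T a b
      simp only
      linarith)
    linarith
  have hV0 : 0 ≤ val S φ := hval0 S Relation.ReflTransGen.refl φ
  obtain ⟨B, hBd⟩ : ∃ B, B = val S φ + 2 * ω := ⟨_, rfl⟩
  have hB0 : 0 < B := by linarith
  obtain ⟨ψ, x, ν, hν, hψ, hx, hsub⟩ := subdiff_exists hr hL s hsl hs0 φ (ω / 10)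
    (ω / (4 * (B + 1))) (by positivity) (by positivity)
  obtain ⟨t, ht0, ht1, htB⟩ : ∃ t, 0 < t ∧ t ≤ 1 ∧ t * B ≤ ν := by
    refine ⟨min 1 (ν / (B + 1)), by positivity, min_le_left _ _, ?_⟩
    calc min 1 (ν / (B + 1)) * B ≤ ν / (B + 1) * (B + 1) := by
          gcongr
          · exact min_le_right _ _
          · linarith
      _ = ν := by field_simp
  obtain ⟨δ, hδ⟩ : ∃ δ, δ = ω * t / 20 := ⟨_, rfl⟩
  have hδ0 : 0 < δ := by rw [hδ]; positivity
  have hδω : δ ≤ ω / 20 := by rw [hδ]; nlinarith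
  obtain ⟨_, ⟨T0, hT0, rfl⟩, hT0s⟩ := Real.lt_sInf_add_pos (hAne ψ) hδ0
  change val T0 ψ < s ψ + δ at hT0s
  change Relation.ReflTransGen rD S T0 at hT0
  have hψn : ‖ψ‖ ≤ ‖φ‖ + ω / 10 := by
    have := norm_add_le (ψ - φ) φ
    rw [sub_add_cancel] at this
    linarith
  obtain ⟨S', hstep, hS'v⟩ := step_exists hd hK hF hc hB (hRv T0 hT0).1 (φ := ψ) (by linarith)
    hω hω2 hδ0
  have hSψ : s ψ ≤ val S φ + ω / 10 := by
    have h1 := hsle ψ S Relation.ReflTransGen.refl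
    have h2 := val_le S ψ φ
    linarith
  have hφψ : ∀ T, val T φ ≤ val T ψ + ω / 10 := by
    intro T
    have := val_le T φ ψ
    rw [norm_sub_rev] at this
    linarith
  have hr1 : rD T0 S' := by
    refine ⟨ψ, by simp only; linarith, hstep, ?_⟩
    have := hφψ S'
    simp only
    linarith
  have hsubrel : ∀ T T', rel K F x0 R ⟨S', ψ, δ⟩ T T' → rD T T' := by
    rintro T T' ⟨φ', h1, h2, h3⟩
    simp only at h1 h2 h3
    refine ⟨φ', ?_, h2.mono hδ0 (by linarith), ?_⟩
    · have := norm_add_le (φ' - ψ) (ψ - φ)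
      rw [sub_add_sub_cancel] at this
      simp only
      linarith
    · have := hφψ T'
      simp only
      linarith
  have htrans : Relation.TransGen rD S S' := Relation.TransGen.tail' hT0 hr1
  refine ⟨⟨S', ψ, δ⟩, ⟨hstep.1, hδ0, by simp only; linarith, by simp only; linarith⟩, htrans,
    hsubrel, by simp only; linarith, by simp only; linarith, x, ?_, ?_⟩
  · refine hx.trans ?_
    have : ω / (4 * (B + 1)) ≤ ω := by
      rw [div_le_iff₀ (by positivity)]; nlinarith
    linarith
  · intro T hT
    simp only at hT ⊢
    have hTD : Relation.ReflTransGen rD S T :=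
      htrans.to_reflTransGen.trans (Relation.ReflTransGen.mono hsubrel _ _ hT)
    have hTv : val T ψ < val S' ψ + δ := by
      rcases hT.cases_tail with h0 | ⟨T1, -, h0⟩
      · rw [h0]; linarith
      · obtain ⟨φ', -, h1, h2⟩ := h0
        exact h2
    have hTs := hsle ψ T hTD
    refine ⟨?_, ?_⟩
    swap
    · rw [abs_le]; constructor <;> linarith
    have hτ := (hRv T hTD).1.2.1
    have hkB : ‖T.p - ψ‖ ≤ B := by
      have h1 := (hRv T hTD).2
      have h2 := val_le T ψ φ
      unfold val at h2 h1
      unfold val at hBd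
      linarith
    have h1 := hsub (t • (T.p - ψ)) (by
      rw [norm_smul, Real.norm_eq_abs, abs_of_pos ht0]
      calc t * ‖T.p - ψ‖ ≤ t * B := by gcongr
        _ ≤ ν := htB)
    have h2 := hsle (ψ + t • (T.p - ψ)) T hTD
    have h3 : val T (ψ + t • (T.p - ψ)) = (1 - t) * ‖T.p - ψ‖ + T.τ := by
      unfold val
      have : T.p - (ψ + t • (T.p - ψ)) = (1 - t) • (T.p - ψ) := by
        module
      rw [this, norm_smul, Real.norm_eq_abs, abs_of_nonneg (by linarith)]
    rw [norm_smul, Real.norm_eq_abs, abs_of_pos ht0] at h1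
    have h4 : (t • (T.p - ψ)) x = -(t * (ψ - T.p) x) := by simp; ring
    rw [h4] at h1
    rw [h3] at h2
    have h5 : ω / (4 * (B + 1)) * (t * ‖T.p - ψ‖) ≤ t * (ω / 4) := by
      calc ω / (4 * (B + 1)) * (t * ‖T.p - ψ‖) ≤ ω / (4 * (B + 1)) * (t * (B + 1)) := by
            gcongr; linarith
        _ = t * (ω / 4) := by field_simp
    have h6 : val T ψ = ‖T.p - ψ‖ + T.τ := rfl
    have h7 : t * ‖T.p - ψ‖ - t * ω ≤ t * (ψ - T.p) x := by
      have : 3 * δ = t * (3 * ω / 20) := by rw [hδ]; ring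
      nlinarith
    have h8 : t * (‖T.p - ψ‖ - ω) ≤ t * (ψ - T.p) x := by rw [mul_sub]; exact h7
    exact le_of_mul_le_mul_left h8 ht0
end
end RLS


namespace RLS

def PathL {α : Type*} (r : α → α → Prop) (t : α) : ℕ → α → Prop
  | 0, a => a = t
  | (l + 1), a => ∃ a', r a a' ∧ PathL r t l a'

lemma pathL_of_transGen {α : Type*} {r : α → α → Prop} {a t : α} (h : Relation.TransGen r a t) :
    ∃ l, PathL r t (l + 1) a := by
  induction h using Relation.TransGen.head_induction_on with
  | single h => exact ⟨0, t, h, rfl⟩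
  | head h1 h2 ih =>
    obtain ⟨l, hl⟩ := ih
    exact ⟨l + 1, _, h1, hl⟩

lemma concat {α : Type*} (r : ℕ → α → α → Prop) (S : ℕ → α)
    (h : ∀ n, Relation.TransGen (r n) (S n) (S (n + 1))) :
    ∃ (T : ℕ → α) (idx : ℕ → ℕ), Monotone idx ∧ (∀ k, ∃ m, k ≤ idx m) ∧
      ∀ m, r (idx m) (T m) (T (m + 1)) ∧ Relation.ReflTransGen (r (idx m)) (S (idx m)) (T m) := by
  let σ := {q : ℕ × ℕ × α // PathL (r q.1) (S (q.1 + 1)) (q.2.1 + 1) q.2.2 ∧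
    Relation.ReflTransGen (r q.1) (S q.1) q.2.2}
  have hstart : ∀ n, ∃ q : σ, q.1.1 = n ∧ q.1.2.2 = S n := by
    intro n
    obtain ⟨l, hl⟩ := pathL_of_transGen (h n)
    exact ⟨⟨(n, l, S n), hl, Relation.ReflTransGen.refl⟩, rfl, rfl⟩
  have hnext : ∀ q : σ, ∃ q' : σ, r q.1.1 q.1.2.2 q'.1.2.2 ∧
      ((q.1.2.1 = 0 ∧ q'.1.1 = q.1.1 + 1) ∨ (q.1.2.1 = q'.1.2.1 + 1 ∧ q'.1.1 = q.1.1)) := by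
    rintro ⟨⟨n, l, a⟩, ⟨a', h1, h2⟩, h3⟩
    simp only at *
    cases l with
    | zero =>
      obtain ⟨q, hq1, hq2⟩ := hstart (n + 1)
      refine ⟨q, ?_, Or.inl ⟨rfl, hq1⟩⟩
      rw [hq2]
      have : a' = S (n + 1) := h2
      rwa [← this]
    | succ l =>
      exact ⟨⟨(n, l, a'), h2, h3.tail h1⟩, h1, Or.inr ⟨rfl, rfl⟩⟩
  choose nx hnx1 hnx2 using hnext
  obtain ⟨q0, hq0, -⟩ := hstart 0
  obtain ⟨Q, hQ⟩ : ∃ Q : ℕ → σ, ∀ m, Q (m + 1) = nx (Q m) :=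
    ⟨fun m => Nat.rec q0 (fun _ q => nx q) m, fun m => rfl⟩
  have key : ∀ l m, (Q m).1.2.1 = l → ∃ m', (Q m).1.1 + 1 = (Q m').1.1 := by
    intro l
    induction l with
    | zero =>
      intro m hm
      refine ⟨m + 1, ?_⟩
      rw [hQ]
      rcases hnx2 (Q m) with h1 | h1
      · exact h1.2.symm
      · omega
    | succ l ih =>
      intro m hm
      rcases hnx2 (Q m) with h1 | h1
      · omega
      · rw [← hQ] at h1
        obtain ⟨m', hm'⟩ := ih (m + 1) (by omega)
        exact ⟨m', by omega⟩
  refine ⟨fun m => (Q m).1.2.2, fun m => (Q m).1.1, ?_, ?_, ?_⟩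
  · apply monotone_nat_of_le_succ
    intro m
    rcases hnx2 (Q m) with h1 | h1 <;> rw [← hQ] at h1 <;> omega
  · intro k
    induction k with
    | zero => exact ⟨0, Nat.zero_le _⟩
    | succ k ih =>
      obtain ⟨m, hm⟩ := ih
      obtain ⟨m', hm'⟩ := key _ m rfl
      refine ⟨m', ?_⟩
      simp only at hm ⊢
      omega
  · intro m
    refine ⟨?_, (Q m).2.2⟩
    simp only [hQ]
    exact hnx1 (Q m)

lemma rel_iter {α : Type*} (r : ℕ → α → α → Prop) (S : ℕ → α)
    (hr : ∀ n a b, r (n + 1) a b → r n a b)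
    (h : ∀ n, Relation.TransGen (r n) (S n) (S (n + 1))) (n k : ℕ) :
    (∀ a b, r (n + k) a b → r n a b) ∧ Relation.ReflTransGen (r n) (S n) (S (n + k)) := by
  induction k with
  | zero => exact ⟨fun a b h => h, Relation.ReflTransGen.refl⟩
  | succ k ih =>
    refine ⟨fun a b hab => ih.1 _ _ (hr _ _ _ hab), ?_⟩
    exact ih.2.trans (Relation.ReflTransGen.mono ih.1 _ _ (h (n + k)).to_reflTransGen)

section
variable {X : Type*} [NormedAddCommGroup X] [NormedSpace ℝ X]

set_option maxHeartbeats 1000000 in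
lemma seq_exists [CompleteSpace X] (hX : StandingAssumptions X)
    {K : Set X} (hK : IsClosed K) {F : X → ℝ} {ℓ : ℝ} (hℓ : 0 ≤ ℓ)
    (hF : ∀ x ∈ K, ∀ y ∈ K, |F x - F y| ≤ ℓ * ‖x - y‖) {x0 : X} (hx0 : x0 ∈ K) {R c : ℝ}
    (hR : 0 < R) (hc : 0 < c) (hB : HB K F x0 R (2 * c)) :
    ∃ (T : ℕ → St X) (ψ : ℕ → X →L[ℝ] ℝ) (e : ℕ → ℝ) (φ : X →L[ℝ] ℝ) (r : ℝ),
      ‖φ‖ ≤ c ∧ c ≤ r ∧ (∀ m, Valid K F x0 R (T m)) ∧ (∀ m, 0 < e m) ∧ (∀ m, e m ≤ 1 / 2) ∧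
      Tendsto e atTop (𝓝 0) ∧ Tendsto ψ atTop (𝓝 φ) ∧
      (∀ m, StepR K F x0 R (ψ m) (e m) (T m) (T (m + 1))) ∧
      Tendsto (fun m => ‖(T m).p - φ‖) atTop (𝓝 r) ∧
      ∀ ε > (0:ℝ), ∃ x : X, ‖x‖ ≤ 1 + ε ∧ ∀ᶠ m in atTop, r - ε ≤ (φ - (T m).p) x := by
  have hFc : ContinuousOn F K := by
    have : LipschitzOnWith ⟨ℓ, hℓ⟩ F K := by
      apply LipschitzOnWith.of_dist_le_mul
      intro x hx y hy
      rw [Real.dist_eq, dist_eq_norm]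
      exact hF x hx y hy
    exact this.continuousOn
  have htr := fun D : {D : Stg X // SV K F x0 R c D} => transition hX hK hFc hc hB D.1 D.2
  choose nx hnx1 hnx2 hnx3 hnx4 hnx5 xx hnx6 hnx7 using htr
  have hstart : SV K F x0 R c ⟨⟨x0, 0, ℓ + 1, R⟩, 0, min (1 / 2) c⟩ := by
    refine ⟨⟨hx0, by simp only; positivity, hR, by simp, ?_⟩, by simp only; positivity,
      min_le_left _ _, by simp⟩
    intro z hz _
    have := (abs_le.1 (hF z hz x0 hx0)).1
    have h2 := norm_nonneg (z - x0)
    simp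
    linarith
  obtain ⟨D, hD⟩ : ∃ D : ℕ → {D : Stg X // SV K F x0 R c D},
      ∀ n, (D (n + 1)) = ⟨nx (D n), hnx1 (D n)⟩ :=
    ⟨fun m => Nat.rec ⟨_, hstart⟩ (fun _ q => ⟨nx q, hnx1 q⟩) m, fun m => rfl⟩
  have hD1 : ∀ n, (D (n + 1)).1 = nx (D n) := fun n => by rw [hD]
  have hω0 : ∀ n, 0 < (D n).1.ω := fun n => (D n).2.2.1
  have hω1 : ∀ n, (D n).1.ω ≤ 1 / 2 := fun n => (D n).2.2.2.1
  have hωs : ∀ n, (D (n + 1)).1.ω ≤ (D n).1.ω / 2 := fun n => by rw [hD1]; exact hnx4 (D n)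
  have hφs : ∀ n, ‖(D (n + 1)).1.φ - (D n).1.φ‖ ≤ (D n).1.ω / 2 := fun n => by
    rw [hD1]; exact hnx5 (D n)
  have hφc : ∀ n, ‖(D n).1.φ‖ ≤ c := fun n => by
    have := (D n).2.2.2.2
    have := hω0 n
    linarith
  have hωb : ∀ n, (D n).1.ω ≤ (1 / 2) ^ n := by
    intro n
    induction n with
    | zero => have := hω1 0; simp; linarith
    | succ n ih =>
      have := hωs n
      rw [pow_succ]; linarith
  have hωt : Tendsto (fun n => (D n).1.ω) atTop (𝓝 0) :=
    squeeze_zero (fun n => (hω0 n).le) hωb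
      (tendsto_pow_atTop_nhds_zero_of_lt_one (by norm_num) (by norm_num))
  have hφd : ∀ n k, ‖(D (n + k)).1.φ - (D n).1.φ‖ ≤ (D n).1.ω - (D (n + k)).1.ω := by
    intro n k
    induction k with
    | zero => simp
    | succ k ih =>
      have h1 := hφs (n + k)
      have h2 := hωs (n + k)
      have h3 := norm_add_le ((D (n + k + 1)).1.φ - (D (n + k)).1.φ)
        ((D (n + k)).1.φ - (D n).1.φ)
      rw [sub_add_sub_cancel] at h3
      rw [← add_assoc]
      linarith
  have hcau : CauchySeq (fun n => (D n).1.φ) := by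
    rw [Metric.cauchySeq_iff']
    intro e he
    obtain ⟨N, hN⟩ := (hωt.eventually_lt_const he).exists
    refine ⟨N, fun n hn => ?_⟩
    obtain ⟨k, rfl⟩ := Nat.exists_eq_add_of_le hn
    rw [dist_eq_norm]
    have := hφd N k
    have := hω0 (N + k)
    linarith
  obtain ⟨φ, hφ⟩ := cauchySeq_tendsto_of_complete hcau
  have hφn : ∀ n, ‖φ - (D n).1.φ‖ ≤ (D n).1.ω := by
    intro n
    refine le_of_tendsto ((hφ.sub_const _).norm) (eventually_atTop.2 ⟨n, fun m hm => ?_⟩)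
    obtain ⟨k, rfl⟩ := Nat.exists_eq_add_of_le hm
    have := hφd n k
    have := hω0 (n + k)
    linarith
  have hφc' : ‖φ‖ ≤ c := le_of_tendsto hφ.norm (Eventually.of_forall hφc)
  have hrn : ∀ n T T', rel K F x0 R (D (n + 1)).1 T T' → rel K F x0 R (D n).1 T T' := by
    intro n T T' h
    rw [hD1] at h
    exact hnx3 (D n) T T' h
  have hSn : ∀ n, Relation.TransGen (rel K F x0 R (D n).1) (D n).1.S (D (n + 1)).1.S := by
    intro n; rw [hD1]; exact hnx2 (D n)
  obtain ⟨T, idx, hmono, hunb, hT⟩ := concat (fun n => rel K F x0 R (D n).1)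
    (fun n => (D n).1.S) hSn
  have hidx : Tendsto idx atTop atTop := tendsto_atTop_atTop_of_monotone hmono hunb
  have hT1 := fun m => (hT m).1
  choose ψ hψ1 hψ2 hψ3 using hT1
  have hTn : ∀ n, ∀ m, n ≤ idx m → Relation.ReflTransGen (rel K F x0 R (D n).1) (D n).1.S (T m) := by
    intro n m hnm
    obtain ⟨k, hk⟩ := Nat.exists_eq_add_of_le hnm
    have h1 := (hT m).2
    have h2 := rel_iter (fun n => rel K F x0 R (D n).1) (fun n => (D n).1.S) hrn hSn n k
    rw [← hk] at h2
    exact h2.2.trans (Relation.ReflTransGen.mono h2.1 _ _ h1)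
  have hVal : ∀ m, Valid K F x0 R (T m) := by
    intro m
    rcases (hT m).2.cases_tail with h0 | ⟨T0, -, h0⟩
    · rw [h0]; exact (D (idx m)).2.1
    · obtain ⟨φ', -, h1, h2⟩ := h0
      exact h1.1
  have hekey : ∀ n m, n + 1 ≤ idx m →
      ‖(T m).p - φ‖ - 3 * (D n).1.ω ≤ (φ - (T m).p) (xx (D n)) ∧
      |val (T m) φ - val (D (n + 1)).1.S (D (n + 1)).1.φ| ≤ 2 * (D n).1.ω := by
    intro n m hnm
    have h1 := hTn (n + 1) m hnm
    rw [hD1] at h1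
    obtain ⟨h2, h3⟩ := hnx7 (D n) _ h1
    rw [← hD1] at h2 h3
    have h4 := hφn (n + 1)
    have h5 := hωs n
    have h6 := hω0 n
    have h7 := hω1 n
    have h8 := hnx6 (D n)
    constructor
    · have a1 := norm_sub_le ((T m).p - (D (n + 1)).1.φ) (φ - (D (n + 1)).1.φ)
      rw [sub_sub_sub_cancel_right] at a1
      have a2 := (abs_le.1 ((φ - (D (n + 1)).1.φ).le_opNorm (xx (D n)))).1
      have a3 : (φ - (T m).p) (xx (D n)) =
        ((D (n + 1)).1.φ - (T m).p) (xx (D n)) + (φ - (D (n + 1)).1.φ) (xx (D n)) := by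
        simp
      have a4 : ‖φ - (D (n + 1)).1.φ‖ * ‖xx (D n)‖ ≤ ((D n).1.ω / 2) * 2 := by
        gcongr <;> linarith
      rw [a3]
      linarith
    · have a1 := val_le (T m) φ (D (n + 1)).1.φ
      have a2 := val_le (T m) (D (n + 1)).1.φ φ
      rw [norm_sub_rev] at a2
      rw [abs_le] at h3 ⊢
      constructor <;> linarith
  have hvc : CauchySeq (fun m => val (T m) φ) := by
    rw [Metric.cauchySeq_iff']
    intro e he
    obtain ⟨n, hn⟩ := (hωt.eventually_lt_const (show 0 < e / 4 by positivity)).exists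
    obtain ⟨N, hN⟩ := hunb (n + 1)
    refine ⟨N, fun m hm => ?_⟩
    have h1 := (hekey n N hN).2
    have h2 := (hekey n m (hN.trans (hmono hm))).2
    rw [abs_le] at h1 h2
    rw [Real.dist_eq, abs_lt]
    constructor <;> linarith
  obtain ⟨r, hr⟩ := cauchySeq_tendsto_of_complete hvc
  have het : Tendsto (fun m => (D (idx m)).1.ω) atTop (𝓝 0) := hωt.comp hidx
  have hτt : Tendsto (fun m => (T m).τ) atTop (𝓝 0) := by
    rw [← tendsto_add_atTop_iff_nat 1]
    exact squeeze_zero (fun m => (hVal _).2.1.le) (fun m => (hψ2 m).2.2.2.2.1) het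
  have hpt : Tendsto (fun m => ‖(T m).p - φ‖) atTop (𝓝 r) := by
    have := hr.sub hτt
    simpa [val] using this
  refine ⟨T, ψ, fun m => (D (idx m)).1.ω, φ, r, hφc', ?_, hVal, fun m => hω0 _, fun m => hω1 _,
    het, ?_, hψ2, hpt, ?_⟩
  · exact ge_of_tendsto hr (Eventually.of_forall fun m => (val_gt hB (hVal m) hφc').le)
  · rw [tendsto_iff_norm_sub_tendsto_zero]
    refine squeeze_zero (fun m => norm_nonneg _) (fun m => ?_)
      (by simpa using het.const_mul 2)
    have h1 := hψ1 m
    have h2 := hφn (idx m)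
    have h3 := norm_sub_le (ψ m - (D (idx m)).1.φ) (φ - (D (idx m)).1.φ)
    rw [sub_sub_sub_cancel_right] at h3
    linarith
  · intro ε hε
    obtain ⟨n, hn⟩ := (hωt.eventually_lt_const (show 0 < ε / 4 by positivity)).exists
    refine ⟨xx (D n), (hnx6 (D n)).trans (by linarith), ?_⟩
    filter_upwards [hpt.eventually_const_lt (show r - ε / 4 < r by linarith),
      hidx.eventually_ge_atTop (n + 1)] with m h1 h2
    have := (hekey n m h2).1
    linarith
end
end RLS


namespace RLS
section
variable {X : Type*} [NormedAddCommGroup X] [NormedSpace ℝ X]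

lemma weak_cluster (w : ℕ → X →L[ℝ] ℝ) (C : ℝ) (h : ∀ m, ‖w m‖ ≤ C) (U : Ultrafilter ℕ) :
    ∃ a : X →L[ℝ] ℝ, ∀ x, Tendsto (fun m => w m x) U (𝓝 (a x)) := by
  have hc := WeakDual.isCompact_closedBall (0 : StrongDual ℝ X) C
  obtain ⟨a, -, ha⟩ := hc.ultrafilter_le_nhds (U.map fun m => StrongDual.toWeakDual (w m)) (by
    simp only [Ultrafilter.coe_map, le_principal_iff, mem_map]
    filter_upwards with m
    simpa using h m)
  refine ⟨WeakDual.toStrongDual a, fun x => ?_⟩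
  have h1 : Tendsto (fun m => StrongDual.toWeakDual (w m)) U (𝓝 a) := ha
  exact ((WeakDual.eval_continuous x).tendsto a).comp h1

lemma strong_conv (hL : LocUnifConvex (X →L[ℝ] ℝ)) (w : ℕ → X →L[ℝ] ℝ) (r : ℝ) (hr : 0 < r)
    (hw : Tendsto (fun m => ‖w m‖) atTop (𝓝 r))
    (H : ∀ ε > (0:ℝ), ∃ x : X, ‖x‖ ≤ 1 + ε ∧ ∀ᶠ m in atTop, r - ε ≤ w m x) :
    ∃ a : X →L[ℝ] ℝ, ‖a‖ = r ∧ Tendsto w atTop (𝓝 a) := by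
  obtain ⟨C, hC⟩ := hw.bddAbove_range
  obtain ⟨a, ha⟩ := weak_cluster w C (fun m => hC ⟨m, rfl⟩) (Filter.hyperfilter ℕ)
  have hU : (Filter.hyperfilter ℕ : Filter ℕ) ≤ atTop := Nat.hyperfilter_le_atTop
  have ha1 : ‖a‖ ≤ r := by
    apply ContinuousLinearMap.opNorm_le_bound _ hr.le
    intro x
    refine le_of_tendsto_of_tendsto (ha x).norm ((hw.mul_const ‖x‖).mono_left hU)
      (Eventually.of_forall fun m => (w m).le_opNorm x)
  have hax : ∀ ε > (0:ℝ), ∃ x : X, ‖x‖ ≤ 1 + ε ∧ r - ε ≤ a x ∧ ∀ᶠ m in atTop, r - ε ≤ w m x := by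
    intro ε hε
    obtain ⟨x, hx, h⟩ := H ε hε
    exact ⟨x, hx, ge_of_tendsto (ha x) (hU h), h⟩
  have ha2 : r ≤ ‖a‖ := by
    apply le_of_forall_pos_le_add
    intro ε hε
    obtain ⟨x, hx, h, -⟩ := hax (ε / (1 + r)) (by positivity)
    have h1 := (le_abs_self _).trans (a.le_opNorm x)
    have h2 : ‖a‖ * ‖x‖ ≤ ‖a‖ * (1 + ε / (1 + r)) := by gcongr
    have h3 : ‖a‖ * (ε / (1 + r)) ≤ r * (ε / (1 + r)) := by gcongr
    have h4 : r * (ε / (1 + r)) + ε / (1 + r) = ε := by field_simp; ring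
    linarith
  refine ⟨a, le_antisymm ha1 ha2, ?_⟩
  have hna : ‖a‖ = r := le_antisymm ha1 ha2
  rw [Metric.tendsto_atTop']
  intro e he
  have hn : ‖r⁻¹ • a‖ = 1 := by
    rw [norm_smul, hna, norm_inv, Real.norm_eq_abs, abs_of_pos hr, inv_mul_cancel₀ hr.ne']
  obtain ⟨δ, hδ, hLδ⟩ := luc_ext hL _ hn (e / r) (by positivity)
  obtain ⟨x, hx, h, h'⟩ := hax (r * δ / (4 * (1 + r))) (by positivity)
  have hev := h'.and (hw.eventually_lt_const (show r < r * (1 + δ) by nlinarith))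
  obtain ⟨N, hN⟩ := eventually_atTop.1 hev
  refine ⟨N, fun m hm => ?_⟩
  obtain ⟨h1, h2⟩ := hN m hm.le
  have h3 := hLδ (r⁻¹ • w m) (by
    rw [norm_smul, norm_inv, Real.norm_eq_abs, abs_of_pos hr, inv_mul_le_iff₀ hr]
    exact h2.le) (by
    rw [← smul_add, norm_smul, norm_inv, Real.norm_eq_abs, abs_of_pos hr, lt_inv_mul_iff₀ hr]
    obtain ⟨ε, hε⟩ : ∃ ε, ε = r * δ / (4 * (1 + r)) := ⟨_, rfl⟩
    rw [← hε] at h h1 hx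
    have hε0 : 0 < ε := by rw [hε]; positivity
    have hε2 : 2 * ε + 2 * r * ε < r * δ := by
      have : 4 * (1 + r) * ε = r * δ := by rw [hε]; field_simp
      nlinarith
    have a1 := (le_abs_self _).trans ((a + w m).le_opNorm x)
    rw [_root_.add_apply] at a1
    have a2 : ‖a + w m‖ * ‖x‖ ≤ ‖a + w m‖ * (1 + ε) := by gcongr
    have a3 : r * (2 - δ) * (1 + ε) < ‖a + w m‖ * (1 + ε) := by
      have : 0 ≤ r * δ * ε := by positivity
      nlinarith
    exact lt_of_mul_lt_mul_right a3 (by positivity))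
  have h4 : r⁻¹ • a - r⁻¹ • w m = r⁻¹ • (a - w m) := by module
  rw [h4, norm_smul, norm_inv, Real.norm_eq_abs, abs_of_pos hr, inv_mul_lt_iff₀ hr,
    mul_div_cancel₀ _ hr.ne'] at h3
  rwa [dist_comm, dist_eq_norm]

lemma mem_closed_span (hr : Function.Surjective (⇑(NormedSpace.inclusionInDoubleDual ℝ X)))
    (Y : Submodule ℝ (X →L[ℝ] ℝ)) (hY : IsClosed (Y : Set (X →L[ℝ] ℝ))) (a : X →L[ℝ] ℝ)
    (h : ∀ x : X, (∀ y ∈ Y, y x = 0) → a x = 0) : a ∈ Y := by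
  by_contra hcon
  obtain ⟨f, u, hu1, hu2⟩ := geometric_hahn_banach_point_closed Y.convex hY hcon
  obtain ⟨x, rfl⟩ := hr f
  have h0 := hu2 0 Y.zero_mem
  rw [map_zero] at h0
  have h1 := h x (fun y hy => by
    by_contra hne
    have := hu2 ((u / y x) • y) (Y.smul_mem _ hy)
    simp at this
    rw [div_mul_cancel₀ _ hne] at this
    exact lt_irrefl _ this)
  simp [h1] at hu1
  linarith

lemma weak_seq (hr : Function.Surjective (⇑(NormedSpace.inclusionInDoubleDual ℝ X)))
    (u : ℕ → X →L[ℝ] ℝ) (C : ℝ) (hu : ∀ m, ‖u m‖ ≤ C) :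
    ∃ (a : X →L[ℝ] ℝ) (σ : ℕ → ℕ), StrictMono σ ∧
      ∀ x, Tendsto (fun m => u (σ m) x) atTop (𝓝 (a x)) := by
  set Y := (Submodule.span ℝ (range u)).topologicalClosure with hY
  have hYc : IsClosed (Y : Set (X →L[ℝ] ℝ)) := Submodule.isClosed_topologicalClosure _
  have hsep : TopologicalSpace.IsSeparable (Y : Set (X →L[ℝ] ℝ)) := by
    rw [hY, Submodule.topologicalClosure_coe]
    apply TopologicalSpace.IsSeparable.closure
    exact ((countable_range u).isSeparable).span
  obtain ⟨c, hcc, hcY⟩ := hsep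
  obtain ⟨v, hv⟩ := (hcc.union (countable_singleton (0 : X →L[ℝ] ℝ))).exists_eq_range
    ⟨0, Or.inr rfl⟩
  have hx : ∀ i, ∃ x : X, ‖x‖ ≤ 1 ∧ v i x = ‖v i‖ := by
    intro i
    by_cases h0 : v i = 0
    · exact ⟨0, by simp, by simp [h0]⟩
    · obtain ⟨x, h1, h2⟩ := exists_norming hr _ h0
      exact ⟨x, h1.le, h2⟩
  choose x hx1 hx2 using hx
  have hcomp : IsCompact (Set.pi univ fun _ : ℕ => Icc (-C) C) :=
    isCompact_univ_pi fun _ => isCompact_Icc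
  have hub : ∀ m z, ‖z‖ ≤ 1 → |u m z| ≤ C := by
    intro m z hz
    have h1 := (u m).le_opNorm z
    rw [Real.norm_eq_abs] at h1
    have h2 : ‖u m‖ * ‖z‖ ≤ C * 1 := by
      gcongr
      · exact (norm_nonneg _).trans (hu m)
      · exact hu m
    linarith
  obtain ⟨g, -, σ, hσ, hg⟩ := hcomp.tendsto_subseq (x := fun m i => u m (x i)) (by
    intro m i _
    exact abs_le.1 (hub m _ (hx1 i)))
  rw [tendsto_pi_nhds] at hg
  -- limits lie in Y
  have hmem : ∀ (U : Ultrafilter ℕ) (a : X →L[ℝ] ℝ),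
      (∀ z, Tendsto (fun m => u (σ m) z) U (𝓝 (a z))) → a ∈ Y := by
    intro U a ha
    apply mem_closed_span hr Y hYc
    intro z hz
    have h1 : ∀ m, u (σ m) z = 0 := fun m => hz _ (by
      apply Submodule.le_topologicalClosure
      exact Submodule.subset_span ⟨_, rfl⟩)
    have h2 := ha z
    simp only [h1] at h2
    exact tendsto_nhds_unique h2 tendsto_const_nhds
  have huniq : ∀ (d : X →L[ℝ] ℝ), d ∈ Y → (∀ i, d (x i) = 0) → d = 0 := by
    intro d hd hdx
    rw [← norm_le_zero_iff]
    apply le_of_forall_pos_le_add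
    intro e he
    have h1 := hcY hd
    rw [Metric.mem_closure_iff] at h1
    obtain ⟨q, hq, hdq⟩ := h1 (e / 3) (by positivity)
    have h2 : q ∈ range v := by rw [← hv]; exact Or.inl hq
    obtain ⟨i, rfl⟩ := h2
    rw [dist_eq_norm, norm_sub_rev] at hdq
    have h3 := (le_abs_self _).trans ((v i - d).le_opNorm (x i))
    have h4 : ‖v i - d‖ * ‖x i‖ ≤ ‖v i - d‖ * 1 := by gcongr; exact hx1 i
    rw [_root_.sub_apply, hdx i, hx2 i] at h3
    have h5 := norm_sub_le (v i) (v i - d)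
    rw [sub_sub_cancel] at h5
    linarith
  obtain ⟨a, ha⟩ := weak_cluster (fun m => u (σ m)) C (fun m => hu _) (Filter.hyperfilter ℕ)
  have hU : (Filter.hyperfilter ℕ : Filter ℕ) ≤ atTop := Nat.hyperfilter_le_atTop
  refine ⟨a, σ, hσ, fun z => ?_⟩
  rw [tendsto_iff_ultrafilter]
  intro U hUt
  obtain ⟨b, hb⟩ := weak_cluster (fun m => u (σ m)) C (fun m => hu _) U
  have hab : b - a = 0 := by
    apply huniq _ (Y.sub_mem (hmem U b hb) (hmem _ a ha))
    intro i
    have h1 := tendsto_nhds_unique (ha (x i)) ((hg i).mono_left hU)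
    have h2 := tendsto_nhds_unique (hb (x i)) ((hg i).mono_left hUt)
    rw [_root_.sub_apply, h1, h2, sub_self]
  rw [sub_eq_zero] at hab
  rw [← hab]
  exact hb z
end
end RLS


namespace RLS
section
variable {X : Type*} [NormedAddCommGroup X] [NormedSpace ℝ X]

lemma geom_conv [CompleteSpace X] (y : ℕ → X) (e : ℕ → ℝ) (he : ∀ m, e m ≤ 1 / 2)
    (h : ∀ m, ‖y (m + 2) - y (m + 1)‖ ≤ e (m + 1) * ‖y (m + 1) - y m‖) :
    ∃ a : X, Tendsto y atTop (𝓝 a) ∧ (∀ m, ‖a - y m‖ ≤ 2 * ‖y (m + 1) - y m‖) ∧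
      Tendsto (fun m => ‖y (m + 1) - y m‖) atTop (𝓝 0) := by
  have hh : ∀ m, ‖y (m + 2) - y (m + 1)‖ ≤ ‖y (m + 1) - y m‖ / 2 := by
    intro m
    have h1 := h m
    have h2 : e (m + 1) * ‖y (m + 1) - y m‖ ≤ 1 / 2 * ‖y (m + 1) - y m‖ := by
      gcongr; exact he _
    linarith
  have hb : ∀ m, ‖y (m + 1) - y m‖ ≤ ‖y 1 - y 0‖ * (1 / 2) ^ m := by
    intro m
    induction m with
    | zero => simp
    | succ m ih =>
      have := hh m
      rw [pow_succ]
      rw [show m + 1 + 1 = m + 2 from rfl]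
      linarith
  have ht : Tendsto (fun m => ‖y (m + 1) - y m‖) atTop (𝓝 0) := by
    refine squeeze_zero (fun m => norm_nonneg _) hb ?_
    have := (tendsto_pow_atTop_nhds_zero_of_lt_one (r := (1 / 2 : ℝ)) (by norm_num)
      (by norm_num)).const_mul ‖y 1 - y 0‖
    simpa using this
  have hd : ∀ n k, ‖y (n + k) - y n‖ ≤
      2 * ‖y (n + 1) - y n‖ - 2 * ‖y (n + k + 1) - y (n + k)‖ := by
    intro n k
    induction k with
    | zero => simp
    | succ k ih =>
      have h1 := hh (n + k)
      have h3 := norm_add_le (y (n + k + 1) - y (n + k)) (y (n + k) - y n)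
      rw [sub_add_sub_cancel] at h3
      rw [← add_assoc, show n + k + 1 + 1 = n + k + 2 from rfl]
      linarith
  have hcau : CauchySeq y := by
    rw [Metric.cauchySeq_iff']
    intro δ hδ
    obtain ⟨N, hN⟩ := (ht.eventually_lt_const (show 0 < δ / 2 by positivity)).exists
    refine ⟨N, fun n hn => ?_⟩
    obtain ⟨k, rfl⟩ := Nat.exists_eq_add_of_le hn
    rw [dist_eq_norm]
    have h1 := hd N k
    have h2 := norm_nonneg (y (N + k + 1) - y (N + k))
    linarith
  obtain ⟨a, ha⟩ := cauchySeq_tendsto_of_complete hcau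
  refine ⟨a, ha, fun n => ?_, ht⟩
  refine le_of_tendsto ((ha.sub_const _).norm) (eventually_atTop.2 ⟨n, fun m hm => ?_⟩)
  obtain ⟨k, rfl⟩ := Nat.exists_eq_add_of_le hm
  have h1 := hd n k
  have h2 := norm_nonneg (y (n + k + 1) - y (n + k))
  linarith

lemma clm_le_of_local (g : X →L[ℝ] ℝ) (e ν : ℝ) (hν : 0 < ν)
    (h : ∀ w : X, ‖w‖ ≤ ν → g w ≤ e * ‖w‖) (w : X) : g w ≤ e * ‖w‖ := by
  by_cases hw : w = 0
  · simp [hw]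
  have hp : 0 < ‖w‖ := norm_pos_iff.2 hw
  have := h ((ν / ‖w‖) • w) (by
    rw [norm_smul, Real.norm_eq_abs, abs_of_pos (by positivity), div_mul_cancel₀ _ hp.ne'])
  rw [norm_smul, Real.norm_eq_abs, abs_of_pos (by positivity), map_smul, smul_eq_mul] at this
  have h2 : (ν / ‖w‖) * g w ≤ (ν / ‖w‖) * (e * ‖w‖) := by linarith
  exact le_of_mul_le_mul_left h2 (by positivity)

lemma smooth_unif (db : X) (hdb : ‖db‖ = 1)
    (hd : DifferentiableAt ℝ (fun y : X => ‖y‖) db)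
    (jb : X →L[ℝ] ℝ) (hjb : ‖jb‖ ≤ 1) (hjd : jb db = 1) (d : ℕ → X) (hdn : ∀ m, ‖d m‖ = 1)
    (j : ℕ → X →L[ℝ] ℝ) (hdt : Tendsto d atTop (𝓝 db)) (hjt : Tendsto j atTop (𝓝 jb))
    (e : ℝ) (he : 0 < e) :
    ∃ ν > (0:ℝ), ν ≤ e ∧ ∀ᶠ m in atTop, ∀ w : X, ‖w‖ ≤ ν →
      ‖d m + w‖ ≤ 1 + j m w + 2 * e * ‖w‖ := by
  obtain ⟨j0, hj0, hj0d, hsm⟩ := normdiff hd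
  rw [hdb] at hj0d hsm
  have hle : ∀ δ > (0:ℝ), ∀ w, (jb - j0) w ≤ δ * ‖w‖ := by
    intro δ hδ
    obtain ⟨ν, hν, H⟩ := hsm δ hδ
    apply clm_le_of_local _ δ ν hν
    intro w hw
    have h1 := H w hw
    have h2 := (le_abs_self _).trans (jb.le_opNorm (db + w))
    have h3 : ‖jb‖ * ‖db + w‖ ≤ 1 * ‖db + w‖ := by gcongr
    rw [map_add, hjd] at h2
    simp only [_root_.sub_apply]
    linarith
  have hle0 : ∀ w, (jb - j0) w ≤ 0 := by
    intro w
    apply le_of_forall_pos_le_add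
    intro δ hδ
    have h1 := hle (δ / (‖w‖ + 1)) (by positivity) w
    have h2 : δ / (‖w‖ + 1) * ‖w‖ ≤ δ / (‖w‖ + 1) * (‖w‖ + 1) := by gcongr; linarith
    rw [div_mul_cancel₀ _ (by positivity)] at h2
    linarith
  have hjj : j0 = jb := by
    ext w
    have h1 := hle0 w
    have h2 := hle0 (-w)
    rw [map_neg] at h2
    simp only [_root_.sub_apply] at h1 h2
    linarith
  subst hjj
  obtain ⟨ν0, hν0, H⟩ := hsm e he
  obtain ⟨ν, hν, hν1, hν2⟩ : ∃ ν > (0:ℝ), ν ≤ ν0 ∧ ν ≤ e :=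
    ⟨min ν0 e, by positivity, min_le_left _ _, min_le_right _ _⟩
  refine ⟨ν, hν, hν2, ?_⟩
  have t1 : Tendsto (fun m => ‖j m - j0‖ * ν + ‖d m - db‖) atTop (𝓝 0) := by
    have a1 := tendsto_iff_norm_sub_tendsto_zero.1 hdt
    have a2 := tendsto_iff_norm_sub_tendsto_zero.1 hjt
    simpa using (a2.mul_const ν).add a1
  filter_upwards [t1.eventually_lt_const (show 0 < e * ν by positivity)] with m hm w hw
  by_cases hw0 : w = 0
  · simp [hw0, hdn]
  have hp : 0 < ‖w‖ := norm_pos_iff.2 hw0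
  obtain ⟨t, ht⟩ : ∃ t, t = ‖w‖ / ν := ⟨_, rfl⟩
  have ht0 : 0 < t := by rw [ht]; positivity
  have ht1 : t ≤ 1 := by rw [ht, div_le_one hν]; exact hw
  obtain ⟨w1, hw1⟩ : ∃ w1, w1 = t⁻¹ • w := ⟨_, rfl⟩
  have hww : w = t • w1 := by rw [hw1, smul_smul, mul_inv_cancel₀ ht0.ne', one_smul]
  have hw1n : ‖w1‖ = ν := by
    rw [hw1, norm_smul, norm_inv, Real.norm_eq_abs, abs_of_pos ht0, ht]
    field_simp
  have h1 := H w1 (by rw [hw1n]; exact hν1)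
  have h2 : ‖d m + w1‖ ≤ ‖db + w1‖ + ‖d m - db‖ := by
    have := norm_add_le (db + w1) (d m - db)
    have e1 : db + w1 + (d m - db) = d m + w1 := by abel
    rwa [e1] at this
  have h3 := (abs_le.1 ((j m - j0).le_opNorm w1)).1
  rw [hw1n] at h3 h1
  simp only [_root_.sub_apply] at h3
  have h4 : ‖d m + w1‖ ≤ 1 + j m w1 + 2 * e * ν := by linarith
  have h5 : d m + w = (1 - t) • d m + t • (d m + w1) := by rw [hww]; module
  have h6 : ‖d m + w‖ ≤ (1 - t) * 1 + t * ‖d m + w1‖ := by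
    rw [h5]
    refine (norm_add_le _ _).trans ?_
    rw [norm_smul, norm_smul, Real.norm_eq_abs, Real.norm_eq_abs, abs_of_pos ht0,
      abs_of_nonneg (by linarith), hdn]
  have h7 : j m w = t * j m w1 := by rw [hww, map_smul, smul_eq_mul]
  have h8 : ‖w‖ = t * ν := by rw [ht]; field_simp
  rw [h7, h8]
  nlinarith

/-- far estimate at one index -/
lemma far_est {K : Set X} {F : X → ℝ} {ℓ : ℝ} (hℓ : 0 ≤ ℓ)
    (hF : ∀ x ∈ K, ∀ y ∈ K, |F x - F y| ≤ ℓ * ‖x - y‖)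
    {a y0 y1 z : X} (haK : a ∈ K) (hy1 : y1 ∈ K)
    {p0 pb ψ : X →L[ℝ] ℝ} {k ρ ρ1 e e1 τ0 ν : ℝ} (hν : 0 < ν) (hρ : ρ = ‖y1 - y0‖)
    (ha0 : ‖a - y0‖ ≤ 2 * ρ) (ha1 : ‖a - y1‖ ≤ 2 * ρ1) (hρ1 : ρ1 ≤ e1 * ρ) (he : 0 < e)
    (hτ0 : 0 < τ0)
    (hdrop : k * ρ ≤ (1 + e) * ((F y0 - ψ y0) - (F y1 - ψ y1)))
    (hsub : F y0 + p0 (z - y0) - τ0 * ‖z - y0‖ ≤ F z)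
    (hfar : ν / 2 * ρ ≤ ‖z - a‖) :
    F a + pb (z - a) - (‖p0 - pb‖ +
      (|‖p0 - ψ‖ + 2 * (ℓ + ‖p0‖) * e1 - k / (1 + e)| + 2 * τ0) * (2 / ν) + τ0) * ‖z - a‖
      ≤ F z := by
  have hρ0 : 0 ≤ ρ := by rw [hρ]; exact norm_nonneg _
  have h1 := (abs_le.1 (hF a haK y1 hy1)).2
  have h2 := (abs_le.1 (p0.le_opNorm (a - y1))).1
  have h3 := (abs_le.1 ((p0 - ψ).le_opNorm (y1 - y0))).1
  rw [← hρ] at h3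
  have h4 : k / (1 + e) * ρ ≤ (F y0 - ψ y0) - (F y1 - ψ y1) := by
    rw [div_mul_eq_mul_div, div_le_iff₀ (by positivity)]; linarith
  have h5 : ℓ * ‖a - y1‖ ≤ ℓ * (2 * (e1 * ρ)) := by gcongr; linarith
  have h6 : ‖p0‖ * ‖a - y1‖ ≤ ‖p0‖ * (2 * (e1 * ρ)) := by gcongr; linarith
  obtain ⟨β, hβ⟩ : ∃ β, β = ‖p0 - ψ‖ + 2 * (ℓ + ‖p0‖) * e1 - k / (1 + e) := ⟨_, rfl⟩
  have h7 : F a - β * ρ ≤ F y0 + p0 (a - y0) := by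
    have e0 : p0 (a - y0) = p0 (a - y1) + p0 (y1 - y0) := by simp
    simp only [_root_.sub_apply, map_sub] at h3 e0 ⊢
    rw [map_sub] at h2
    rw [hβ]
    linarith
  rw [← hβ]
  have h8 : β * ρ ≤ |β| * ρ := by gcongr; exact le_abs_self _
  have h9 : ‖z - y0‖ ≤ ‖z - a‖ + 2 * ρ := by
    have := norm_add_le (z - a) (a - y0)
    rw [sub_add_sub_cancel] at this
    linarith
  have h10 : ρ ≤ 2 / ν * ‖z - a‖ := by
    rw [div_mul_eq_mul_div, le_div_iff₀ hν]; linarith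
  have h11 := (abs_le.1 ((p0 - pb).le_opNorm (z - a))).1
  have h12 : τ0 * ‖z - y0‖ ≤ τ0 * (‖z - a‖ + 2 * ρ) := by gcongr
  have h13 : (|β| + 2 * τ0) * ρ ≤ (|β| + 2 * τ0) * (2 / ν * ‖z - a‖) := by gcongr
  simp only [_root_.sub_apply, map_sub] at h11 hsub h7 ⊢
  nlinarith

set_option maxHeartbeats 600000 in
/-- near estimate at one index -/
lemma near_est {K : Set X} {F : X → ℝ} {ℓ : ℝ} (hℓ : 0 ≤ ℓ)
    (hF : ∀ x ∈ K, ∀ y ∈ K, |F x - F y| ≤ ℓ * ‖x - y‖)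
    {a y0 y1 z : X} (haK : a ∈ K) (hy1 : y1 ∈ K)
    {p1 pb ψ j : X →L[ℝ] ℝ} {k ρ ρ1 τ1 ν e M : ℝ} (hρ : ρ = ‖y1 - y0‖) (hρ0 : 0 < ρ)
    (hk : 0 ≤ k) (hτ1 : 0 < τ1) (hM : 2 ≤ M) (hνe : ν ≤ e) (he : 0 < e)
    (ha1 : ‖a - y1‖ ≤ 2 * ρ1) (hp1 : p1 = ψ - k • j)
    (hsm : ∀ w : X, ‖w‖ ≤ ν → ‖ρ⁻¹ • (y1 - y0) + w‖ ≤ 1 + j w + 2 * e * ‖w‖)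
    (hI : F y1 - ψ y1 - k / (2 * ρ) * (‖z - y0‖ ^ 2 - ρ ^ 2) - τ1 * ‖z - y1‖ ≤ F z - ψ z)
    (hlow : M * ρ1 ≤ ‖z - a‖) (hnear : ‖z - a‖ ≤ ν / 2 * ρ) :
    F a + pb (z - a) - (‖p1 - pb‖ + 2 * (ℓ + ‖p1‖) / M + 6 * e * k + 2 * τ1) * ‖z - a‖
      ≤ F z := by
  have hM0 : 0 < M := by linarith
  have ht0 := norm_nonneg (z - a)
  have hρ1 : 2 * ρ1 ≤ 2 / M * ‖z - a‖ := by
    rw [div_mul_eq_mul_div, le_div_iff₀ hM0]; linarith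
  have hρ1' : 2 * ρ1 ≤ ‖z - a‖ := by
    have h0 : 0 ≤ ρ1 := by have := norm_nonneg (a - y1); linarith
    nlinarith
  have hs : ‖z - y1‖ ≤ 2 * ‖z - a‖ := by
    have := norm_add_le (z - a) (a - y1)
    rw [sub_add_sub_cancel] at this
    linarith
  obtain ⟨w, hw⟩ : ∃ w, w = ρ⁻¹ • (z - y1) := ⟨_, rfl⟩
  have hwn : ρ * ‖w‖ = ‖z - y1‖ := by
    rw [hw, norm_smul, norm_inv, Real.norm_eq_abs, abs_of_pos hρ0, mul_inv_cancel_left₀ hρ0.ne']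
  have hwν : ‖w‖ ≤ ν := by
    have : ρ * ‖w‖ ≤ ρ * ν := by rw [hwn]; linarith
    exact le_of_mul_le_mul_left this hρ0
  have h1 := hsm w hwν
  have hdn : ‖ρ⁻¹ • (y1 - y0)‖ = 1 := by
    rw [norm_smul, norm_inv, Real.norm_eq_abs, abs_of_pos hρ0, ← hρ, inv_mul_cancel₀ hρ0.ne']
  have h2 : ‖z - y0‖ = ρ * ‖ρ⁻¹ • (y1 - y0) + w‖ := by
    have : z - y0 = ρ • (ρ⁻¹ • (y1 - y0) + w) := by
      rw [hw, ← smul_add, smul_smul, mul_inv_cancel₀ hρ0.ne', one_smul]; abel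
    rw [this, norm_smul, Real.norm_eq_abs, abs_of_pos hρ0]
  have h3 : |‖ρ⁻¹ • (y1 - y0) + w‖ - 1| ≤ ‖w‖ := by
    have := abs_norm_sub_norm_le (ρ⁻¹ • (y1 - y0) + w) (ρ⁻¹ • (y1 - y0))
    rwa [hdn, add_sub_cancel_left] at this
  obtain ⟨A, hA⟩ : ∃ A, A = ‖ρ⁻¹ • (y1 - y0) + w‖ := ⟨_, rfl⟩
  rw [← hA] at h1 h2 h3
  have hw0 := norm_nonneg w
  have h4 : (A - 1) ^ 2 ≤ ν * ‖w‖ := by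
    rw [← sq_abs (A - 1)]
    calc |A - 1| ^ 2 ≤ ‖w‖ ^ 2 := by gcongr
      _ = ‖w‖ * ‖w‖ := by ring
      _ ≤ ν * ‖w‖ := by gcongr
  have h5 : k / (2 * ρ) * (‖z - y0‖ ^ 2 - ρ ^ 2) = k * ρ * ((A - 1) + (A - 1) ^ 2 / 2) := by
    rw [h2]; field_simp; ring
  have h6 : (A - 1) + (A - 1) ^ 2 / 2 ≤ j w + 3 * e * ‖w‖ := by
    have : ν * ‖w‖ ≤ e * ‖w‖ := by gcongr
    have : 0 ≤ e * ‖w‖ := by positivity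
    linarith
  have h7 : k * ρ * ((A - 1) + (A - 1) ^ 2 / 2) ≤ k * ρ * (j w + 3 * e * ‖w‖) := by gcongr
  have h8 : ρ * j w = j (z - y1) := by
    rw [hw, map_smul, smul_eq_mul, mul_inv_cancel_left₀ hρ0.ne']
  have h9 : k * ρ * (j w + 3 * e * ‖w‖) = k * j (z - y1) + 3 * e * k * ‖z - y1‖ := by
    rw [← h8, ← hwn]; ring
  have h10 : p1 (z - y1) = ψ z - ψ y1 - k * j (z - y1) := by rw [hp1]; simp
  have h11 : F y1 + p1 (z - y1) - (3 * e * k + τ1) * ‖z - y1‖ ≤ F z := by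
    rw [h10]; rw [h5] at hI; linarith
  have h12 := (abs_le.1 (hF a haK y1 hy1)).2
  have h13 := (abs_le.1 (p1.le_opNorm (a - y1))).1
  have h14 := (abs_le.1 ((p1 - pb).le_opNorm (z - a))).1
  have h15 : (ℓ + ‖p1‖) * ‖a - y1‖ ≤ (ℓ + ‖p1‖) * (2 / M * ‖z - a‖) := by gcongr; linarith
  have h16 : (3 * e * k + τ1) * ‖z - y1‖ ≤ (3 * e * k + τ1) * (2 * ‖z - a‖) := by gcongr
  have h17 : (ℓ + ‖p1‖) * (2 / M * ‖z - a‖) = 2 * (ℓ + ‖p1‖) / M * ‖z - a‖ := by ring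
  simp only [_root_.sub_apply, map_sub] at h11 h13 h14 ⊢
  linarith
end
end RLS


namespace RLS
section
variable {X : Type*} [NormedAddCommGroup X] [NormedSpace ℝ X]

lemma limit_ineq {K : Set X} {F : X → ℝ} {ℓ : ℝ} (hℓ : 0 ≤ ℓ)
    (hF : ∀ x ∈ K, ∀ y ∈ K, |F x - F y| ≤ ℓ * ‖x - y‖)
    (y : ℕ → X) (p ψ j : ℕ → X →L[ℝ] ℝ) (τ b e k : ℕ → ℝ) (a : X) (pb φ : X →L[ℝ] ℝ) (r c : ℝ)
    (hr : 0 < r) (hc : 0 < c) (hy : ∀ m, y m ∈ K) (haK : a ∈ K)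
    (hτ : ∀ m, 0 < τ m) (he : ∀ m, 0 < e m)
    (hsub : ∀ m, ∀ z ∈ K, ‖z - y m‖ ≤ b m → F (y m) + p m (z - y m) - τ m * ‖z - y m‖ ≤ F z)
    (hρ0 : ∀ m, 0 < ‖y (m + 1) - y m‖)
    (hρb : ∀ m, ‖y (m + 1) - y m‖ ≤ e m * b m)
    (hρρ : ∀ m, ‖y (m + 2) - y (m + 1)‖ ≤ e (m + 1) * ‖y (m + 1) - y m‖)
    (hρt : Tendsto (fun m => ‖y (m + 1) - y m‖) atTop (𝓝 0))
    (hay : ∀ m, ‖a - y m‖ ≤ 2 * ‖y (m + 1) - y m‖)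
    (hk : ∀ m, 0 ≤ k m) (hp : ∀ m, p (m + 1) = ψ m - k m • j m)
    (hdrop : ∀ m, k m * ‖y (m + 1) - y m‖ ≤
      (1 + e m) * ((F (y m) - ψ m (y m)) - (F (y (m + 1)) - ψ m (y (m + 1)))))
    (hI : ∀ m, ∀ z ∈ K, ‖z - y m‖ ≤ b m →
      F (y (m + 1)) - ψ m (y (m + 1)) - k m / (2 * ‖y (m + 1) - y m‖) *
        (‖z - y m‖ ^ 2 - ‖y (m + 1) - y m‖ ^ 2) - τ (m + 1) * ‖z - y (m + 1)‖ ≤ F z - ψ m z)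
    (het : Tendsto e atTop (𝓝 0)) (hτt : Tendsto τ atTop (𝓝 0)) (hψt : Tendsto ψ atTop (𝓝 φ))
    (hpt : Tendsto p atTop (𝓝 pb)) (hpr : ‖pb - φ‖ = r) (hkt : Tendsto k atTop (𝓝 r))
    (hsm : ∀ e1 > (0:ℝ), ∃ ν > (0:ℝ), ν ≤ e1 ∧ ∀ᶠ m in atTop, ∀ w : X, ‖w‖ ≤ ν →
      ‖(‖y (m + 1) - y m‖)⁻¹ • (y (m + 1) - y m) + w‖ ≤ 1 + j m w + 2 * e1 * ‖w‖) :
    ∃ s > (0:ℝ), ∀ z ∈ K, ‖z - a‖ ≤ s → F a + pb (z - a) - c * ‖z - a‖ ≤ F z := by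
  obtain ⟨e1, he1d⟩ : ∃ e1, e1 = c / (24 * r) := ⟨_, rfl⟩
  have he1 : 0 < e1 := by rw [he1d]; positivity
  obtain ⟨M, hMd⟩ : ∃ M, M = 2 + 8 * (ℓ + ‖pb‖) / c := ⟨_, rfl⟩
  have hM2 : 2 ≤ M := by
    rw [hMd]
    have : 0 ≤ 8 * (ℓ + ‖pb‖) / c := by positivity
    linarith
  have hM0 : 0 < M := by linarith
  obtain ⟨ν, hν, hνe, hsmν⟩ := hsm e1 he1
  have h1 : Tendsto (fun m => (M + 2) * e m) atTop (𝓝 0) := by simpa using het.const_mul (M + 2)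
  have h2 : Tendsto (fun m => (ν + 1 + 2) * e m) atTop (𝓝 0) := by
    simpa using het.const_mul (ν + 1 + 2)
  have hps : Tendsto (fun m => ‖p m - ψ m‖) atTop (𝓝 r) := by
    rw [← hpr]; exact (hpt.sub hψt).norm
  have hpn : Tendsto (fun m => ‖p m‖) atTop (𝓝 ‖pb‖) := hpt.norm
  have hpb : Tendsto (fun m => ‖p m - pb‖) atTop (𝓝 0) := by
    simpa using (hpt.sub_const pb).norm
  have het1 : Tendsto (fun m => e (m + 1)) atTop (𝓝 0) := (tendsto_add_atTop_iff_nat 1).2 het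
  have h3 : Tendsto (fun m => ‖p m - pb‖ +
      (|‖p m - ψ m‖ + 2 * (ℓ + ‖p m‖) * e (m + 1) - k m / (1 + e m)| + 2 * τ m) * (2 / ν) + τ m)
      atTop (𝓝 0) := by
    have q1 : Tendsto (fun m => k m / (1 + e m)) atTop (𝓝 (r / (1 + 0))) :=
      hkt.div (het.const_add 1) (by norm_num)
    have q2 := ((hpb.add ((((((hps.add (((hpn.const_add ℓ).const_mul 2).mul het1)).sub q1).abs).add
      (hτt.const_mul 2)).mul_const (2 / ν)))).add hτt)
    simpa using q2
  have h4 : Tendsto (fun m => ‖p (m + 1) - pb‖ + 2 * (ℓ + ‖p (m + 1)‖) / M + 6 * e1 * k m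
      + 2 * τ (m + 1)) atTop (𝓝 (0 + 2 * (ℓ + ‖pb‖) / M + 6 * e1 * r + 2 * 0)) := by
    have s1 := (tendsto_add_atTop_iff_nat 1).2 hpb
    have s2 := (tendsto_add_atTop_iff_nat 1).2 hpn
    have s3 := (tendsto_add_atTop_iff_nat 1).2 hτt
    exact ((s1.add (((s2.const_add ℓ).const_mul 2).div_const M)).add (hkt.const_mul (6 * e1))).add
      (s3.const_mul 2)
  have h4' : 0 + 2 * (ℓ + ‖pb‖) / M + 6 * e1 * r + 2 * 0 < c := by
    have a1 : 6 * e1 * r = c / 4 := by rw [he1d]; field_simp; norm_num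
    have a2 : 2 * (ℓ + ‖pb‖) / M ≤ c / 4 := by
      rw [div_le_iff₀ hM0, hMd]
      have : c / 4 * (2 + 8 * (ℓ + ‖pb‖) / c) = c / 2 + 2 * (ℓ + ‖pb‖) := by field_simp; ring
      linarith
    linarith
  obtain ⟨N, hN⟩ := eventually_atTop.1
    ((h1.eventually_lt_const one_pos).and ((h2.eventually_lt_const one_pos).and
      ((h3.eventually_lt_const hc).and ((h4.eventually_lt_const h4').and hsmν))))
  refine ⟨M * ‖y (N + 1) - y N‖, by have := hρ0 N; positivity, fun z hz hzs => ?_⟩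
  by_cases hza : z = a
  · subst hza; simp
  have ht0 : 0 < ‖z - a‖ := norm_pos_iff.2 (sub_ne_zero.2 hza)
  have hex : ∃ n, M * ‖y (N + n + 1 + 1) - y (N + n + 1)‖ ≤ ‖z - a‖ := by
    have q : Tendsto (fun n => M * ‖y (n + 1) - y n‖) atTop (𝓝 0) := by
      simpa using hρt.const_mul M
    obtain ⟨L, hL⟩ := eventually_atTop.1 (q.eventually_lt_const ht0)
    exact ⟨L, (hL (N + L + 1) (by omega)).le⟩
  obtain ⟨m, hmN, hlo, hhi⟩ : ∃ m, N ≤ m ∧ M * ‖y (m + 1 + 1) - y (m + 1)‖ ≤ ‖z - a‖ ∧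
      ‖z - a‖ ≤ M * ‖y (m + 1) - y m‖ := by
    classical
    refine ⟨N + Nat.find hex, by omega, Nat.find_spec hex, ?_⟩
    rcases hn : Nat.find hex with _ | n
    · simpa using hzs
    · have := Nat.find_min hex (m := n) (by omega)
      exact (not_le.1 this).le
  obtain ⟨g1, g2, g3, g4, g5⟩ := hN m hmN
  have hzy : ‖z - y m‖ ≤ ‖z - a‖ + 2 * ‖y (m + 1) - y m‖ := by
    have := norm_add_le (z - a) (a - y m)
    rw [sub_add_sub_cancel] at this
    linarith [hay m]
  have hbm : 0 < b m := by
    have := (hρ0 m).trans_le (hρb m)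
    exact (pos_iff_pos_of_mul_pos this).1 (he m)
  rcases le_total (ν / 2 * ‖y (m + 1) - y m‖) ‖z - a‖ with hfar | hnear
  · have hzb : ‖z - y m‖ ≤ b m := by
      have q1 : (M + 2) * ‖y (m + 1) - y m‖ ≤ (M + 2) * (e m * b m) := by gcongr; exact hρb m
      have q2 : ((M + 2) * e m) * b m ≤ 1 * b m := by gcongr
      linarith
    have := far_est hℓ hF haK (hy (m + 1)) (pb := pb) hν rfl (hay m) (hay (m + 1)) (hρρ m) (he m)
      (hτ m) (hdrop m) (hsub m z hz hzb) hfar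
    have q3 := mul_le_mul_of_nonneg_right g3.le ht0.le
    linarith
  · have hzb : ‖z - y m‖ ≤ b m := by
      have q1 : (ν + 1 + 2) * ‖y (m + 1) - y m‖ ≤ (ν + 1 + 2) * (e m * b m) := by
        gcongr; exact hρb m
      have q2 : ((ν + 1 + 2) * e m) * b m ≤ 1 * b m := by gcongr
      have q3 : 0 ≤ ν * ‖y (m + 1) - y m‖ := by positivity
      have q4 := hρ0 m
      linarith
    have := near_est hℓ hF haK (hy (m + 1)) (pb := pb) rfl (hρ0 m) (hk m) (hτ (m + 1)) hM2 hνe he1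
      (hay (m + 1)) (hp m) g5 (hI m z hz hzb) hlo hnear
    have q3 := mul_le_mul_of_nonneg_right g4.le ht0.le
    linarith

/-- directions converge by local uniform convexity -/
lemma dir_conv (hX : LocUnifConvex X) (db : X) (hdb : ‖db‖ = 1) (jb : X →L[ℝ] ℝ) (hjd : jb db = 1)
    (d : ℕ → X) (hdn : ∀ m, ‖d m‖ = 1) (j : ℕ → X →L[ℝ] ℝ) (hj : ∀ m, ‖j m‖ ≤ 1)
    (hjm : ∀ m, j m (d m) = 1) (hjt : Tendsto j atTop (𝓝 jb)) : Tendsto d atTop (𝓝 db) := by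
  rw [Metric.tendsto_atTop]
  intro δ hδ
  obtain ⟨η, hη, H⟩ := hX db hdb δ hδ
  have a2 := tendsto_iff_norm_sub_tendsto_zero.1 hjt
  obtain ⟨N, hN⟩ := eventually_atTop.1 (a2.eventually_lt_const hη)
  refine ⟨N, fun m hm => ?_⟩
  rw [dist_eq_norm, norm_sub_rev]
  apply H _ (hdn m)
  have h1 := (le_abs_self _).trans ((j m).le_opNorm (db + d m))
  have h2 : ‖j m‖ * ‖db + d m‖ ≤ 1 * ‖db + d m‖ := by gcongr; exact hj m
  have h3 := (abs_le.1 ((j m - jb).le_opNorm db)).1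
  rw [hdb] at h3
  simp only [_root_.sub_apply, map_add] at h1 h3
  rw [hjm] at h1
  have := hN m hm
  linarith
end
end RLS


namespace RLS
section
variable {X : Type*} [NormedAddCommGroup X] [NormedSpace ℝ X]

lemma u_bound {K : Set X} {F : X → ℝ} {ℓ : ℝ} 
    (hF : ∀ x ∈ K, ∀ y ∈ K, |F x - F y| ≤ ℓ * ‖x - y‖) {x : X} (hx : x ∈ K) {ε s : ℝ}
    (hs : 0 < s) (hℓε : 0 ≤ ℓ + ε) {u : X →L[ℝ] ℝ} (hu : u ∈ dualityMapSet (tanCone K x))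
    (h : ∀ z ∈ K, ‖z - x‖ ≤ s → F x + u (z - x) - ε * ‖z - x‖ ≤ F z) : ‖u‖ ≤ ℓ + ε := by
  simp only [dualityMapSet, mem_iUnion] at hu
  obtain ⟨v, ⟨t, w, ht, htt, hwt, hK⟩, h1, h2⟩ := hu
  have hsm : Tendsto (fun k => ‖t k • w k‖) atTop (𝓝 0) := by
    simpa using (htt.smul hwt).norm
  have key : u v ≤ (ℓ + ε) * ‖v‖ := by
    refine le_of_tendsto_of_tendsto ((u.continuous.tendsto v).comp hwt)
      (hwt.norm.const_mul (ℓ + ε)) ?_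
    filter_upwards [hsm.eventually_lt_const hs] with k hk
    have a1 := h _ (hK k) (by rw [add_sub_cancel_left]; exact hk.le)
    have a2 := (abs_le.1 (hF _ (hK k) x hx)).2
    rw [add_sub_cancel_left] at a1 a2
    rw [norm_smul, Real.norm_eq_abs, abs_of_pos (ht k)] at a1 a2
    rw [map_smul, smul_eq_mul] at a1
    have : t k * u (w k) ≤ t k * ((ℓ + ε) * ‖w k‖) := by linarith
    exact le_of_mul_le_mul_left this (ht k)
  have h3 : ‖v‖ = ‖u‖ := by
    have : ‖v‖ ^ 2 = ‖u‖ ^ 2 := by rw [← h1, h2]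
    exact (pow_left_inj₀ (norm_nonneg _) (norm_nonneg _) two_ne_zero).1 this
  rw [h3, h2] at key
  rcases (norm_nonneg u).eq_or_lt with h0 | h0
  · rw [← h0]; exact hℓε
  · nlinarith

set_option maxHeartbeats 800000 in
lemma main_claim [CompleteSpace X] (hX : StandingAssumptions X)
    {K : Set X} (hK : IsClosed K) {F : X → ℝ} {ℓ : ℝ} (hℓ : 0 ≤ ℓ)
    (hF : ∀ x ∈ K, ∀ y ∈ K, |F x - F y| ≤ ℓ * ‖x - y‖) {x0 : X} (hx0 : x0 ∈ K) {R ε : ℝ}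
    (hR : 0 < R) (hε : 0 < ε) :
    ∃ x ∈ K, ‖x - x0‖ ≤ R ∧ ∃ u ∈ dualityMapSet (tanCone K x), ∃ s > (0:ℝ),
      ∀ z ∈ K, ‖z - x‖ ≤ s → F x + u (z - x) - ε * ‖z - x‖ ≤ F z := by
  by_cases hB : HB K F x0 R ε
  swap
  · unfold HB at hB
    push Not at hB
    obtain ⟨x, hx, hxR, s, hs, h⟩ := hB
    refine ⟨x, hx, hxR, 0, ?_, s, hs, fun z hz hzs => by simpa using h z hz hzs⟩
    simp only [dualityMapSet, mem_iUnion]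
    refine ⟨0, ⟨fun k => 1 / ((k:ℝ) + 1), fun _ => 0, fun k => by positivity,
      tendsto_one_div_add_atTop_nhds_zero_nat, tendsto_const_nhds, fun k => by simpa using hx⟩, ?_⟩
    simp [dualityMap]
  obtain ⟨c, hcd⟩ : ∃ c, c = ε / 2 := ⟨_, rfl⟩
  have hc : 0 < c := by rw [hcd]; positivity
  have hB' : HB K F x0 R (2 * c) := by
    have : 2 * c = ε := by rw [hcd]; ring
    rwa [this]
  obtain ⟨T, ψ, e, φ, r, hφ, hcr, hV, he, he2, het, hψt, hst, hpr, hH⟩ :=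
    seq_exists hX hK hℓ hF hx0 hR hc hB'
  obtain ⟨hrefl, hlX, hlD, hdiff⟩ := hX
  have hr : 0 < r := by linarith
  obtain ⟨wb, hwbn, hwt⟩ := strong_conv hlD (fun m => φ - (T m).p) r hr
    (by simpa [norm_sub_rev] using hpr) hH
  choose hy hτ hb hyR hsub using hV
  choose _ hρ0 hρb hbρ hτe j k hk hj hjy hp hdrop hI using hst
  have hρρ : ∀ m, ‖(T (m + 2)).y - (T (m + 1)).y‖ ≤ e (m + 1) * ‖(T (m + 1)).y - (T m).y‖ := by
    intro m
    refine (hρb (m + 1)).trans ?_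
    exact mul_le_mul_of_nonneg_left (hbρ m) (he _).le
  obtain ⟨a, hat, hay, hρt⟩ := geom_conv (fun m => (T m).y) e he2 hρρ
  have haK : a ∈ K := hK.mem_of_tendsto hat (Eventually.of_forall hy)
  have haR : ‖a - x0‖ ≤ R := by
    refine le_of_tendsto ((hat.sub_const x0).norm) (Eventually.of_forall fun m => ?_)
    have := hyR m
    have := hb m
    linarith
  have hpt : Tendsto (fun m => (T m).p) atTop (𝓝 (φ - wb)) := by
    have := hwt.const_sub φ
    simpa using this
  have hjn : ∀ m, ‖j m‖ = 1 := by
    intro m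
    apply le_antisymm (hj m)
    have h1 := (le_abs_self _).trans ((j m).le_opNorm ((T (m + 1)).y - (T m).y))
    rw [hjy] at h1
    have h2 := hρ0 m
    nlinarith
  have hkj : Tendsto (fun m => k m • j m) atTop (𝓝 wb) := by
    have h1 := (hψt.sub ((tendsto_add_atTop_iff_nat 1).2 hpt))
    have h2 : φ - (φ - wb) = wb := by abel
    rw [h2] at h1
    refine h1.congr fun m => ?_
    rw [hp m]; abel
  have hkt : Tendsto k atTop (𝓝 r) := by
    rw [← hwbn]
    refine hkj.norm.congr fun m => ?_
    rw [norm_smul, hjn, mul_one, Real.norm_eq_abs, abs_of_nonneg (hk m)]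
  have hjt : Tendsto j atTop (𝓝 (r⁻¹ • wb)) := by
    refine ((hkt.inv₀ hr.ne').smul hkj).congr' ?_
    filter_upwards [hkt.eventually_const_lt hr] with m hm
    rw [smul_smul, inv_mul_cancel₀ hm.ne', one_smul]
  have hwb0 : wb ≠ 0 := by
    rw [← norm_pos_iff, hwbn]; exact hr
  obtain ⟨db, hdb, hwdb⟩ := exists_norming hrefl wb hwb0
  rw [hwbn] at hwdb
  have hjbd : (r⁻¹ • wb) db = 1 := by
    simp [hwdb, hr.ne']
  have hjbn : ‖r⁻¹ • wb‖ ≤ 1 := by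
    rw [norm_smul, hwbn, norm_inv, Real.norm_eq_abs, abs_of_pos hr, inv_mul_cancel₀ hr.ne']
  obtain ⟨d, hd⟩ : ∃ d : ℕ → X, ∀ m, d m =
      (‖(T (m + 1)).y - (T m).y‖)⁻¹ • ((T (m + 1)).y - (T m).y) := ⟨_, fun _ => rfl⟩
  have hdn : ∀ m, ‖d m‖ = 1 := by
    intro m
    rw [hd, norm_smul, norm_inv, norm_norm, inv_mul_cancel₀ (hρ0 m).ne']
  have hjd : ∀ m, j m (d m) = 1 := by
    intro m
    rw [hd, map_smul, hjy, smul_eq_mul, inv_mul_cancel₀ (hρ0 m).ne']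
  have hdt := dir_conv hlX db hdb _ hjbd d hdn j hj hjd hjt
  have hdb0 : db ≠ 0 := by rw [← norm_pos_iff, hdb]; exact one_pos
  have hτt : Tendsto (fun m => (T m).τ) atTop (𝓝 0) := by
    rw [← tendsto_add_atTop_iff_nat 1]
    exact squeeze_zero (fun m => (hτ _).le) hτe het
  obtain ⟨s, hs, hfin⟩ := limit_ineq hℓ hF (fun m => (T m).y) (fun m => (T m).p) ψ j
    (fun m => (T m).τ) (fun m => (T m).b) e k a (φ - wb) φ r c hr hc hy haK hτ he hsub hρ0 hρb hρρ
    hρt hay hk hp hdrop hI het hτt hψt hpt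
    (by rw [sub_sub_cancel_left, norm_neg, hwbn]) hkt
    (by
      intro e1 he1
      have := smooth_unif db hdb (hdiff db hdb0) _ hjbn hjbd d hdn j hdt hjt e1 he1
      simpa only [hd] using this)
  refine ⟨a, haK, haR, -wb, ?_, s, hs, ?_⟩
  · simp only [dualityMapSet, mem_iUnion]
    refine ⟨-(r • db), ⟨fun m => ‖(T (m + 1)).y - (T m).y‖ / r,
      fun m => (r / ‖(T (m + 1)).y - (T m).y‖) • ((T m).y - a), fun m => ?_, ?_, ?_, fun m => ?_⟩, ?_⟩
    · have := hρ0 m; positivity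
    · simpa using hρt.div_const r
    · have hz : Tendsto (fun m => (r / ‖(T (m + 1)).y - (T m).y‖) • (a - (T (m + 1)).y)) atTop
          (𝓝 0) := by
        apply squeeze_zero_norm (a := fun m => 2 * r * e (m + 1))
        · intro m
          have h0 := hρ0 m
          rw [norm_smul, Real.norm_eq_abs, abs_of_pos (by positivity), div_mul_eq_mul_div,
            div_le_iff₀ h0]
          have h1 := (hay (m + 1)).trans (mul_le_mul_of_nonneg_left (hρρ m) zero_le_two)
          have h2 := mul_le_mul_of_nonneg_left h1 hr.le
          linarith
        · simpa using ((tendsto_add_atTop_iff_nat 1).2 het).const_mul (2 * r)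
      have h1 := (hdt.const_smul r).neg.sub hz
      rw [sub_zero] at h1
      refine h1.congr fun m => ?_
      rw [hd, smul_smul, ← div_eq_mul_inv]
      module
    · have h0 := hρ0 m
      rw [smul_smul]
      have : ‖(T (m + 1)).y - (T m).y‖ / r * (r / ‖(T (m + 1)).y - (T m).y‖) = 1 := by
        field_simp
      rw [this, one_smul, add_sub_cancel]
      exact hy m
    · have e1 : (-wb) (-(r • db)) = r ^ 2 := by simp [hwdb]; ring
      refine ⟨?_, ?_⟩
      · rw [e1, norm_neg, norm_smul, hdb, Real.norm_eq_abs, abs_of_pos hr, mul_one]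
      · rw [e1, norm_neg, hwbn]
  · intro z hz hzs
    have h1 := hfin z hz hzs
    have h2 := (abs_le.1 (φ.le_opNorm (z - a))).1
    have h3 : ‖φ‖ * ‖z - a‖ ≤ c * ‖z - a‖ := by gcongr
    have h4 : ε * ‖z - a‖ = c * ‖z - a‖ + c * ‖z - a‖ := by rw [hcd]; ring
    simp only [_root_.sub_apply, _root_.neg_apply] at h1 ⊢
    linarith
end
end RLS


namespace RLS
section
variable {X : Type*} [NormedAddCommGroup X] [NormedSpace ℝ X]

lemma geom_mem {Ω : Set X} {f : X → EReal} {F : X → ℝ} {x : X} {ε s : ℝ} (hε : 0 ≤ ε) (hs : 0 < s)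
    (hx : x ∈ Ω) (hfin : ∀ z ∈ Ω, ‖z - x‖ ≤ s → f z = (F z : EReal)) {u : X →L[ℝ] ℝ}
    (h : ∀ z ∈ Ω, ‖z - x‖ ≤ s → F x + u (z - x) - ε * ‖z - x‖ ≤ F z) :
    u ∈ geomSub ε (restr f Ω) x := by
  have hfx := hfin x hx (by simpa using hs.le)
  refine ⟨F x, by simp [restr, hx, hfx], ?_⟩
  simp only [eNormalProd, mem_setOf_eq]
  refine Filter.limsup_le_of_le (by isBoundedDefault) ?_
  have hnear : ∀ᶠ z : X × ℝ in 𝓝[epiSet (restr f Ω)] (x, F x), ‖z.1 - x‖ < s := by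
    apply mem_nhdsWithin_of_mem_nhds
    have hc : Continuous fun z : X × ℝ => ‖z.1 - x‖ := by fun_prop
    exact hc.tendsto' (x, F x) 0 (by simp) |>.eventually_lt_const hs
  filter_upwards [hnear, self_mem_nhdsWithin] with z hz hze
  simp only [epiSet, mem_setOf_eq, restr] at hze
  split_ifs at hze with hzΩ
  swap
  · simp at hze
  rw [hfin z.1 hzΩ hz.le, EReal.coe_le_coe_iff] at hze
  have h1 := h z.1 hzΩ hz.le
  rw [EReal.coe_le_coe_iff]
  apply div_le_of_le_mul₀ (by positivity) hε
  have := mul_nonneg hε (abs_nonneg (z.2 - F x))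
  linarith

lemma tanCone_mono {A B : Set X} (h : A ⊆ B) (x : X) : tanCone A x ⊆ tanCone B x := by
  rintro v ⟨t, w, h1, h2, h3, h4⟩
  exact ⟨t, w, h1, h2, h3, fun k => h (h4 k)⟩

lemma final [CompleteSpace X]
    (hX : StandingAssumptions X)
    (Ω : Set X) (f : X → EReal) (xb : X) (hxb : xb ∈ Ω)
    (hloc : LocallyClosedAt Ω xb)
    (ℓ : ℝ) (hℓ : 0 ≤ ℓ) (hlip : LocLipRel f Ω xb ℓ) :
    (relLimSub Ω f xb).Nonempty := by
  obtain ⟨r1, hr1, hcl⟩ := hloc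
  obtain ⟨U, hU, hfinU, hlipU⟩ := hlip
  obtain ⟨r2, hr2, hr2U⟩ := Metric.nhds_basis_closedBall.mem_iff.1 hU
  obtain ⟨ρ, hρ, hρ1, hρ2⟩ : ∃ ρ > (0:ℝ), ρ ≤ r1 ∧ ρ ≤ r2 :=
    ⟨min r1 r2, by positivity, min_le_left _ _, min_le_right _ _⟩
  obtain ⟨K, hKd⟩ : ∃ K, K = Ω ∩ Metric.closedBall xb ρ := ⟨_, rfl⟩
  have hKc : IsClosed K := by
    have : K = (Ω ∩ Metric.closedBall xb r1) ∩ Metric.closedBall xb ρ := by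
      rw [hKd, inter_assoc, inter_eq_right.2 (Metric.closedBall_subset_closedBall hρ1)]
    rw [this]
    exact hcl.inter Metric.isClosed_closedBall
  have hKU : ∀ z ∈ K, z ∈ U ∩ Ω := by
    intro z hz
    rw [hKd] at hz
    exact ⟨hr2U (Metric.closedBall_subset_closedBall hρ2 hz.2), hz.1⟩
  have hKΩ : K ⊆ Ω := fun z hz => (hKU z hz).2
  obtain ⟨F, hFd⟩ : ∃ F : X → ℝ, ∀ x, F x = (f x).toReal := ⟨_, fun _ => rfl⟩
  have hfF : ∀ z ∈ K, f z = (F z : EReal) := by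
    intro z hz
    obtain ⟨q, hq⟩ := hfinU z (hKU z hz)
    rw [hFd, hq, EReal.toReal_coe]
  have hF : ∀ x ∈ K, ∀ y ∈ K, |F x - F y| ≤ ℓ * ‖x - y‖ := by
    intro x hx y hy
    rw [hFd, hFd]
    exact hlipU x (hKU x hx) y (hKU y hy)
  have hxK : xb ∈ K := by
    rw [hKd]; exact ⟨hxb, Metric.mem_closedBall_self hρ.le⟩
  have hmain := fun k : ℕ => main_claim hX hKc hℓ hF hxK
    (R := min (ρ / 2) (1 / ((k:ℝ) + 1))) (ε := 1 / ((k:ℝ) + 1)) (by positivity) (by positivity)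
  choose x hx hxR u hu s hs hin using hmain
  have hxt : Tendsto x atTop (𝓝 xb) := by
    rw [tendsto_iff_norm_sub_tendsto_zero]
    exact squeeze_zero (fun k => norm_nonneg _) (fun k => (hxR k).trans (min_le_right _ _))
      tendsto_one_div_add_atTop_nhds_zero_nat
  have hub : ∀ k, ‖u k‖ ≤ ℓ + 1 := by
    intro k
    have h1 := u_bound hF (hx k) (hs k) (by positivity) (hu k) (hin k)
    have h2 : 1 / ((k:ℝ) + 1) ≤ 1 := by
      rw [div_le_one (by positivity)]
      have : (0:ℝ) ≤ k := by positivity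
      linarith
    linarith
  have hft : Tendsto (fun k => f (x k)) atTop (𝓝 (f xb)) := by
    have h1 : Tendsto (fun k => F (x k)) atTop (𝓝 (F xb)) := by
      rw [tendsto_iff_norm_sub_tendsto_zero]
      have h2 := (tendsto_iff_norm_sub_tendsto_zero.1 hxt).const_mul ℓ
      rw [mul_zero] at h2
      exact squeeze_zero (fun k => norm_nonneg _) (fun k => hF _ (hx k) _ hxK) h2
    rw [hfF xb hxK]
    refine ((continuous_coe_real_ereal.tendsto (F xb)).comp h1).congr fun k => ?_
    simp [hfF _ (hx k)]
  have hmem : ∀ k : ℕ, u k ∈ relRegSub (1 / ((k:ℝ) + 1)) Ω f (x k) := by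
    intro k
    have hball : ∀ z ∈ Ω, ‖z - x k‖ ≤ min (ρ / 2) (s k) → z ∈ K := by
      intro z hz hzk
      rw [hKd]
      refine ⟨hz, ?_⟩
      rw [mem_closedBall_iff_norm]
      have h1 := norm_add_le (z - x k) (x k - xb)
      rw [sub_add_sub_cancel] at h1
      have h2 := hzk.trans (min_le_left _ _)
      have h3 := (hxR k).trans (min_le_left _ _)
      linarith
    refine ⟨geom_mem (F := F) (s := min (ρ / 2) (s k)) (by positivity)
      (lt_min (by positivity) (hs k)) (hKΩ (hx k))
      (fun z hz hzk => hfF z (hball z hz hzk))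
      (fun z hz hzk => hin k z (hball z hz hzk) (hzk.trans (min_le_right _ _))), ?_⟩
    have := hu k
    simp only [dualityMapSet, mem_iUnion] at this ⊢
    obtain ⟨v, hv, hv2⟩ := this
    exact ⟨v, tanCone_mono hKΩ _ hv, hv2⟩
  obtain ⟨l, σ, hσ, hl⟩ := weak_seq hX.1 u (ℓ + 1) hub
  refine ⟨l, fun k => 1 / ((σ k : ℝ) + 1), x ∘ σ, u ∘ σ, fun k => by positivity, ?_, ?_,
    fun k => hKΩ (hx _), hxt.comp hσ.tendsto_atTop, hft.comp hσ.tendsto_atTop,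
    fun k => hmem _, hl⟩
  · intro i k hik
    have : (σ i : ℝ) ≤ σ k := by exact_mod_cast hσ.monotone hik
    simp only
    gcongr
  · exact tendsto_one_div_add_atTop_nhds_zero_nat.comp hσ.tendsto_atTop
end
end RLS
/-- nonemptiness of the relative limiting subdifferential. -/
theorem relLimSub_nonempty_of_locLipRel
    {X : Type*} [NormedAddCommGroup X] [NormedSpace ℝ X] [CompleteSpace X]
    (hX : StandingAssumptions X)
    (Ω : Set X) (f : X → EReal) (xb : X) (hxb : xb ∈ Ω) (hdom : f xb ≠ ⊤)
    (hloc : LocallyClosedAt Ω xb) (hlsc : LscRelOn f Ω)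
    (ℓ : ℝ) (hℓ : 0 ≤ ℓ) (hlip : LocLipRel f Ω xb ℓ) :
    (relLimSub Ω f xb).Nonempty := by
  exact RLS.final hX Ω f xb hxb hloc ℓ hℓ hlip
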